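/- For every n ≥ 1, the symmetric coinvariant algebra R_n = B_n/J_n is isomorphic, as a ℂ[S_n]-module, to the direct sum of the regular representation ℂ[S_n] and (n−1) copies of the induced module Ind^{S_n}_{S_2} L_{(1,1)} of the sign representation of S_2. -/

import Mathlib

open MvPolynomial

set_option maxHeartbeats 1000000
set_option synthInstance.maxHeartbeats 400000

noncomputable section

/-- the ideal `(x₁y₁, …, xₙyₙ)`. -/
abbrev Bideal (n : ℕ) : Ideal (MvPolynomial (Fin n ⊕ Fin n) ℂ) :=
  Ideal.span (Set.range fun i : Fin n => X (Sum.inl i) * X (Sum.inr i))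

/-- `B n = ℂ[x₁,…,xₙ,y₁,…,yₙ]/(x₁y₁,…,xₙyₙ)`, the `n`-th tensor power of `ℂ[x,y]/(xy)`.
The variable `x_i` is `X (Sum.inl i)` and `y_i` is `X (Sum.inr i)`. -/
abbrev B (n : ℕ) : Type := MvPolynomial (Fin n ⊕ Fin n) ℂ ⧸ Bideal n

abbrev mkB (n : ℕ) : MvPolynomial (Fin n ⊕ Fin n) ℂ →ₐ[ℂ] B n :=
  Ideal.Quotient.mkₐ ℂ (Bideal n)

def xv (n : ℕ) (i : Fin n) : B n := mkB n (X (Sum.inl i))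
def yv (n : ℕ) (i : Fin n) : B n := mkB n (X (Sum.inr i))

/-- the action of a permutation `σ ∈ Sₙ` on `B n`: `σ·xᵢ = x_{σ i}`, `σ·yᵢ = y_{σ i}`. -/
def permB (n : ℕ) (σ : Equiv.Perm (Fin n)) : B n →ₐ[ℂ] B n :=
  Ideal.Quotient.liftₐ (Bideal n)
    ((mkB n).comp (MvPolynomial.rename (Sum.map ⇑σ ⇑σ)))
    (by
      intro a ha
      have h : Bideal n ≤ RingHom.ker ((mkB n).comp (MvPolynomial.rename (Sum.map ⇑σ ⇑σ))).toRingHom := by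
        rw [Ideal.span_le]
        rintro _ ⟨i, rfl⟩
        simp only [SetLike.mem_coe, RingHom.mem_ker, AlgHom.toRingHom_eq_coe, RingHom.coe_coe,
          AlgHom.comp_apply, map_mul, rename_X, Sum.map_inl, Sum.map_inr]
        rw [← map_mul, Ideal.Quotient.mkₐ_eq_mk, Ideal.Quotient.eq_zero_iff_mem]
        exact Ideal.subset_span ⟨σ i, rfl⟩
      exact h ha)

/-- evaluation at the origin. -/
def ev0 (n : ℕ) : B n →ₐ[ℂ] ℂ :=
  Ideal.Quotient.liftₐ (Bideal n) (aeval fun _ => (0 : ℂ))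
    (by
      intro a ha
      have h : Bideal n ≤ RingHom.ker (aeval (R := ℂ) fun _ : Fin n ⊕ Fin n => (0 : ℂ)).toRingHom := by
        rw [Ideal.span_le]
        rintro _ ⟨i, rfl⟩
        simp [RingHom.mem_ker]
      exact h ha)

/-- `Jₙ`, the ideal of `B n` generated by the `Sₙ`-invariant elements vanishing at the origin. -/
def Jn (n : ℕ) : Ideal (B n) :=
  Ideal.span {p : B n | (∀ σ : Equiv.Perm (Fin n), permB n σ p = p) ∧ ev0 n p = 0}

/-- the symmetric coinvariant algebra `Rₙ = Bₙ/Jₙ`. -/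
abbrev Rn (n : ℕ) : Type := B n ⧸ Jn n

/-- the subgroup `S_{n-m} ≤ Sₙ` of permutations fixing the first `m` letters. -/
def fixLT (n m : ℕ) : Subgroup (Equiv.Perm (Fin n)) where
  carrier := {σ | ∀ k : Fin n, (k : ℕ) < m → σ k = k}
  one_mem' := fun _ _ => rfl
  mul_mem' := by
    intro a b ha hb k hk
    have : (a * b) k = a (b k) := rfl
    rw [this, hb k hk, ha k hk]
  inv_mem' := by
    intro a ha k hk
    have := ha k hk
    conv_lhs => rw [← this]
    exact a.symm_apply_apply k

/-- the left regular action of `Sₙ` on `ℂ[Sₙ]`, realized as functions on `Sₙ`. -/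
def regAct (n : ℕ) (σ : Equiv.Perm (Fin n)) (f : Equiv.Perm (Fin n) → ℂ) :
    Equiv.Perm (Fin n) → ℂ := fun τ => f (σ⁻¹ * τ)

/-- the action of `Sₙ` on the permutation module `ℂ[Sₙ/S_{n-m}]`, realized as
functions on the coset space `Sₙ/S_{n-m}`. -/
def cosetAct (n m : ℕ) (σ : Equiv.Perm (Fin n))
    (f : Equiv.Perm (Fin n) ⧸ fixLT n m → ℂ) :
    Equiv.Perm (Fin n) ⧸ fixLT n m → ℂ := fun x => f (σ⁻¹ • x)

/-- the transposition `(1 2)` generating the subgroup `S₂ ≤ Sₙ`. -/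
def swap01 (n : ℕ) : Equiv.Perm (Fin n) :=
  if h : 1 < n then Equiv.swap ⟨0, by omega⟩ ⟨1, h⟩ else 1

/-- the induced module `Ind^{Sₙ}_{S₂} L_{(1,1)}` of the sign representation of `S₂`,
realized as the space of functions on `Sₙ` transforming by the sign character under
right translation by `S₂`. -/
def SignInd (n : ℕ) : Submodule ℂ (Equiv.Perm (Fin n) → ℂ) where
  carrier := {f | ∀ g, f (g * swap01 n) = - f g}
  zero_mem' := by intro g; simp
  add_mem' := by
    intro f₁ f₂ h₁ h₂ g
    simp only [Pi.add_apply, h₁ g, h₂ g]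
    ring
  smul_mem' := by
    intro c f h g
    simp only [Pi.smul_apply, h g, smul_eq_mul]
    ring

/-- the action of `Sₙ` on `Ind^{Sₙ}_{S₂} L_{(1,1)}`. -/
def signIndAct (n : ℕ) (σ : Equiv.Perm (Fin n)) (f : SignInd n) : SignInd n :=
  ⟨fun τ => (f : Equiv.Perm (Fin n) → ℂ) (σ⁻¹ * τ), by
    intro g
    have := f.2 (σ⁻¹ * g)
    simpa [mul_assoc] using this⟩

section CrossBound

open Finset

variable {S ι : Type*} [CommRing S]

/-- The elements `f` with `b * f ∈ L`. -/
def mulComap (b : S) (L : Ideal S) : Ideal S :=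
  Submodule.comap (LinearMap.lsmul S S b) L

theorem mem_mulComap {b f : S} {L : Ideal S} : f ∈ mulComap b L ↔ b * f ∈ L := Iff.rfl

/-- The elementary symmetric polynomial of degree `k` in the `z i`, `i ∈ s`. -/
def esum (s : Finset ι) (k : ℕ) (z : ι → S) : S := ∑ t ∈ s.powersetCard k, ∏ i ∈ t, z i

theorem esum_zero (s : Finset ι) (z : ι → S) : esum s 0 z = 1 := by simp [esum]

theorem esum_card (s : Finset ι) (z : ι → S) : esum s #s z = ∏ i ∈ s, z i := by simp [esum]

theorem esum_of_card_lt {s : Finset ι} {k : ℕ} (h : #s < k) (z : ι → S) : esum s k z = 0 := by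
  simp [esum, powersetCard_eq_empty.2 h]

/-- `I` contains the variables outside `s`, all `x i * y i`, the elementary symmetric
polynomials of the variables in `s`, and the squarefree monomials of degree `p` in the `x`
and of degree `q` in the `y`. -/
structure CrossIdeal (x y : ι → S) (I : Ideal S) (s : Finset ι) (p q : ℕ) : Prop where
  x_mem : ∀ i ∉ s, x i ∈ I
  y_mem : ∀ i ∉ s, y i ∈ I
  xy_mem : ∀ i, x i * y i ∈ I
  ex_mem : ∀ k, 1 ≤ k → esum s k x ∈ I
  ey_mem : ∀ k, 1 ≤ k → esum s k y ∈ I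
  px_mem : ∀ t ⊆ s, #t = p → ∏ i ∈ t, x i ∈ I
  py_mem : ∀ t ⊆ s, #t = q → ∏ i ∈ t, y i ∈ I

theorem CrossIdeal.symm {x y : ι → S} {I : Ideal S} {s : Finset ι} {p q : ℕ}
    (h : CrossIdeal x y I s p q) : CrossIdeal y x I s q p :=
  ⟨h.y_mem, h.x_mem, fun i => mul_comm (x i) (y i) ▸ h.xy_mem i, h.ey_mem, h.ex_mem, h.py_mem,
    h.px_mem⟩

variable [DecidableEq ι]

theorem esum_insert_succ {s : Finset ι} {a : ι} (ha : a ∉ s) (k : ℕ) (z : ι → S) :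
    esum (insert a s) (k + 1) z = esum s (k + 1) z + z a * esum s k z := by
  unfold esum
  rw [powersetCard_succ_insert ha, sum_union, sum_image, mul_sum]
  · congr 1
    refine sum_congr rfl fun t ht => prod_insert fun h => ha ((mem_powersetCard.1 ht).1 h)
  · intro t ht t' ht' h
    have h1 : a ∉ t := fun h => ha ((mem_powersetCard.1 ht).1 h)
    have h2 : a ∉ t' := fun h => ha ((mem_powersetCard.1 ht').1 h)
    rw [← erase_insert h1, ← erase_insert h2, h]
  · refine disjoint_left.2 fun t ht ht' => ?_
    obtain ⟨u, -, rfl⟩ := mem_image.1 ht'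
    exact ha ((mem_powersetCard.1 ht).1 (mem_insert_self _ _))

/-- If `v` annihilates the elementary symmetric polynomials of a set of variables
modulo `L`, then those of the set without `a` act on `v` as powers of `-z a`. -/
theorem mul_esum_sub_pow_mem {L : Ideal S} {s : Finset ι} {a : ι} (ha : a ∉ s) {z : ι → S} {v : S}
    (hv : ∀ k, 1 ≤ k → v * esum (insert a s) k z ∈ L) (k : ℕ) :
    v * (esum s k z - (-z a) ^ k) ∈ L := by
  induction k with
  | zero => simp [esum_zero]
  | succ k ih =>
    have h := hv (k + 1) (by omega)
    rw [esum_insert_succ ha] at h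
    have := sub_mem h (L.mul_mem_left (z a) ih)
    convert this using 1
    ring

theorem prod_mul_esum_sub_mem {L : Ideal S} {s t : Finset ι} {z u : ι → S}
    (h : ∀ i, z i * u i ∈ L) (k : ℕ) :
    (∏ i ∈ t, u i) * esum s k z - (∏ i ∈ t, u i) * esum (s \ t) k z ∈ L := by
  unfold esum
  rw [← sum_sdiff (powersetCard_mono (n := k) (sdiff_subset (s := s) (t := t))), mul_add,
    add_sub_cancel_right, mul_sum]
  refine sum_mem fun r hr => ?_
  rw [mem_sdiff, mem_powersetCard, mem_powersetCard] at hr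
  have : ∃ i ∈ r, i ∈ t := by
    by_contra! hcon
    exact hr.2 ⟨fun i hi => mem_sdiff.2 ⟨hr.1.1 hi, hcon i hi⟩, hr.1.2⟩
  obtain ⟨i, hir, hit⟩ := this
  rw [← mul_prod_erase _ _ hir, ← mul_prod_erase _ _ hit,
    show ∀ b c d e : S, b * c * (d * e) = (d * b) * (c * e) by intros; ring]
  exact L.mul_mem_right _ (h i)

namespace CrossIdeal

variable {x y : ι → S} {I : Ideal S} {s : Finset ι} {p q : ℕ} {a : ι}

theorem prod_mul_mem (h : CrossIdeal x y I (insert a s) p q) (ha : a ∉ s) {t : Finset ι}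
    (ht : t ⊆ s) (k : ℕ) :
    (∏ i ∈ t, y i) * (esum (s \ t) k x - (-x a) ^ k) ∈ I := by
  refine mul_esum_sub_pow_mem (fun h => ha (mem_sdiff.1 h).1) (fun k hk => ?_) k
  have h1 := prod_mul_esum_sub_mem (s := insert a s) (t := t) h.xy_mem k
  rw [insert_sdiff_of_notMem _ fun h => ha (ht h)] at h1
  exact (I.sub_mem_iff_right (I.mul_mem_left _ (h.ex_mem k hk))).1 h1

theorem pow_mul_prod_mem (h : CrossIdeal x y I (insert a s) p q) (ha : a ∉ s) {t : Finset ι}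
    (ht : t ⊆ s) {j : ℕ} (hj : #t + j = #s + 1) : x a ^ j * ∏ i ∈ t, y i ∈ I := by
  have h1 := h.prod_mul_mem ha ht j
  rw [esum_of_card_lt (by have := card_le_card ht; rw [card_sdiff_of_subset ht]; omega),
    zero_sub, neg_pow] at h1
  have := I.mul_mem_left (-(-1) ^ j) h1
  convert this using 1
  have h2 : ((-1 : S) ^ j) * (-1) ^ j = 1 := by rw [← mul_pow]; simp
  linear_combination (-(x a ^ j * ∏ i ∈ t, y i)) * h2

theorem pow_mem (h : CrossIdeal x y I (insert a s) p q) (ha : a ∉ s) (hp : 1 ≤ p) :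
    x a ^ p ∈ I := by
  obtain ⟨p, rfl⟩ := Nat.exists_eq_add_of_le' hp
  have h1 := h.prod_mul_mem ha (empty_subset s) p
  rw [prod_empty, one_mul, sdiff_empty] at h1
  have h2 : x a * esum s p x ∈ I := by
    unfold esum
    rw [mul_sum]
    refine sum_mem fun t ht => ?_
    obtain ⟨hts, htp⟩ := mem_powersetCard.1 ht
    have hat : a ∉ t := fun h => ha (hts h)
    rw [← prod_insert hat]
    exact h.px_mem _ (insert_subset_insert a hts) (by rw [card_insert_of_notMem hat, htp])
  have := I.mul_mem_left ((-1) ^ p) (sub_mem h2 (I.mul_mem_left (x a) h1))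
  convert this using 1
  rw [neg_pow]
  have h3 : ((-1 : S) ^ p) * (-1) ^ p = 1 := by rw [← mul_pow]; simp
  linear_combination (-(x a ^ (p + 1))) * h3

theorem prod_mul_prod_mem (h : CrossIdeal x y I (insert a s) p q) (ha : a ∉ s) {t : Finset ι}
    (ht : t ⊆ s) (h0 : t.Nonempty) :
    (∏ i ∈ t, x i) * ∏ i ∈ s \ t, y i ∈ I ⊔ Ideal.span {x a} := by
  obtain ⟨k, hk⟩ : ∃ k, #t = k + 1 := Nat.exists_eq_add_of_le' h0.card_pos
  have h1 := prod_mul_esum_sub_mem (s := insert a s) (t := s \ t) h.xy_mem (k + 1)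
  rw [insert_sdiff_of_notMem _ fun h => ha (mem_sdiff.1 h).1, Finset.sdiff_sdiff_eq_self ht,
    esum_insert_succ (fun h => ha (ht h)), ← hk, esum_card] at h1
  have h2 := (I.sub_mem_iff_right (I.mul_mem_left _ (h.ex_mem _ h0.card_pos))).1 h1
  have h3 : (∏ i ∈ s \ t, y i) * esum t k x * x a ∈ Ideal.span {x a} :=
    Ideal.mul_mem_left _ _ (Ideal.mem_span_singleton_self _)
  convert sub_mem (Ideal.mem_sup_left h2 : _ ∈ I ⊔ Ideal.span {x a})
    (Ideal.mem_sup_right h3) using 1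
  ring

theorem pow_mul_prod_mem_sup (h : CrossIdeal x y I (insert a s) p q) (ha : a ∉ s) {t : Finset ι}
    (ht : t ⊆ s) (h0 : t.Nonempty) {j : ℕ} (hj : #t + j = #s) :
    y a ^ j * ∏ i ∈ t, x i ∈ I ⊔ Ideal.span {x a} := by
  have h1 := h.symm.prod_mul_mem ha ht j
  have h2 : #(s \ t) = j := by rw [card_sdiff_of_subset ht]; omega
  rw [← h2, esum_card, h2, neg_pow] at h1
  have := Ideal.mul_mem_left _ ((-1) ^ j)
    (sub_mem (h.prod_mul_prod_mem ha ht h0) (Ideal.mem_sup_left h1))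
  convert this using 1
  have h3 : ((-1 : S) ^ j) * (-1) ^ j = 1 := by rw [← mul_pow]; simp
  linear_combination (-(y a ^ j * ∏ i ∈ t, x i)) * h3

theorem esum_mem {L : Ideal S} {z : ι → S} (ha : a ∉ s) (hz : z a ∈ L)
    (h : ∀ k, 1 ≤ k → esum (insert a s) k z ∈ L) (k : ℕ) (hk : 1 ≤ k) : esum s k z ∈ L := by
  obtain ⟨k, rfl⟩ := Nat.exists_eq_add_of_le' hk
  have := h (k + 1) hk
  rw [esum_insert_succ ha] at this
  exact (L.add_mem_iff_left (L.mul_mem_right _ hz)).1 this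

/-- The layer of `x a ^ j`, `1 ≤ j`. -/
theorem layer_x (h : CrossIdeal x y I (insert a s) p q) (ha : a ∉ s) (hp : 2 ≤ p) {j : ℕ}
    (hj : 1 ≤ j) (hjs : j ≤ #s) :
    CrossIdeal x y (mulComap (x a ^ j) (I ⊔ Ideal.span {x a ^ (j + 1)})) s (p - 1)
      (min q (#s + 1 - j)) := by
  have hle : I ≤ mulComap (x a ^ j) (I ⊔ Ideal.span {x a ^ (j + 1)}) := fun f hf =>
    mem_mulComap.2 (Ideal.mul_mem_left _ _ (Ideal.mem_sup_left hf))
  obtain ⟨i, rfl⟩ := Nat.exists_eq_add_of_le' hj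
  have hx : x a ∈ mulComap (x a ^ (i + 1)) (I ⊔ Ideal.span {x a ^ (i + 1 + 1)}) := by
    rw [mem_mulComap, ← pow_succ]
    exact Ideal.mem_sup_right (Ideal.mem_span_singleton_self _)
  have hy : y a ∈ mulComap (x a ^ (i + 1)) (I ⊔ Ideal.span {x a ^ (i + 1 + 1)}) := by
    rw [mem_mulComap, pow_succ _ i, mul_assoc]
    exact Ideal.mul_mem_left _ _ (Ideal.mem_sup_left (h.xy_mem a))
  refine ⟨fun b hb => ?_, fun b hb => ?_, fun b => hle (h.xy_mem b),
    esum_mem ha hx fun k hk => hle (h.ex_mem k hk), esum_mem ha hy fun k hk => hle (h.ey_mem k hk),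
    fun t ht htp => ?_, fun t ht htq => ?_⟩
  · rcases eq_or_ne b a with rfl | hne
    · exact hx
    · exact hle (h.x_mem b (by simp [hb, hne]))
  · rcases eq_or_ne b a with rfl | hne
    · exact hy
    · exact hle (h.y_mem b (by simp [hb, hne]))
  · have hat : a ∉ t := fun h => ha (ht h)
    rw [mem_mulComap, pow_succ _ i, mul_assoc, ← prod_insert hat]
    refine Ideal.mul_mem_left _ _ (Ideal.mem_sup_left (h.px_mem _ (insert_subset_insert a ht) ?_))
    rw [card_insert_of_notMem hat]; omega
  · rcases le_total q (#s + 1 - (i + 1)) with hq | hq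
    · rw [min_eq_left hq] at htq
      exact hle (h.py_mem t (ht.trans (subset_insert _ _)) htq)
    · rw [min_eq_right hq] at htq
      exact mem_mulComap.2 (Ideal.mem_sup_left (h.pow_mul_prod_mem ha ht (by omega)))

/-- The layer of `y a ^ j`, `1 ≤ j`, modulo `x a`. -/
theorem layer_y (h : CrossIdeal x y I (insert a s) p q) (ha : a ∉ s) (hq : 2 ≤ q) {j : ℕ}
    (hj : 1 ≤ j) (hjs : j ≤ #s) :
    CrossIdeal x y
      (mulComap (y a ^ j) (I ⊔ Ideal.span {x a} ⊔ Ideal.span {y a ^ (j + 1)})) s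
      (min p (max 1 (#s - j))) (q - 1) := by
  set I' := I ⊔ Ideal.span {x a} with hI'
  have hle : I' ≤ mulComap (y a ^ j) (I' ⊔ Ideal.span {y a ^ (j + 1)}) := fun f hf =>
    mem_mulComap.2 (Ideal.mul_mem_left _ _ (Ideal.mem_sup_left hf))
  have hle' : I ≤ mulComap (y a ^ j) (I' ⊔ Ideal.span {y a ^ (j + 1)}) := le_sup_left.trans hle
  have hx : x a ∈ mulComap (y a ^ j) (I' ⊔ Ideal.span {y a ^ (j + 1)}) :=
    hle (Ideal.mem_sup_right (Ideal.mem_span_singleton_self _))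
  have hy : y a ∈ mulComap (y a ^ j) (I' ⊔ Ideal.span {y a ^ (j + 1)}) := by
    rw [mem_mulComap, ← pow_succ]
    exact Ideal.mem_sup_right (Ideal.mem_span_singleton_self _)
  refine ⟨fun b hb => ?_, fun b hb => ?_, fun b => hle' (h.xy_mem b),
    esum_mem ha hx fun k hk => hle' (h.ex_mem k hk),
    esum_mem ha hy fun k hk => hle' (h.ey_mem k hk), fun t ht htp => ?_, fun t ht htq => ?_⟩
  · rcases eq_or_ne b a with rfl | hne
    · exact hx
    · exact hle' (h.x_mem b (by simp [hb, hne]))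
  · rcases eq_or_ne b a with rfl | hne
    · exact hy
    · exact hle' (h.y_mem b (by simp [hb, hne]))
  · rcases le_total p (max 1 (#s - j)) with hp | hp
    · rw [min_eq_left hp] at htp
      exact hle' (h.px_mem t (ht.trans (subset_insert _ _)) htp)
    · rw [min_eq_right hp] at htp
      rw [mem_mulComap]
      refine Ideal.mem_sup_left ?_
      rcases hjs.eq_or_lt with hjs | hjs
      · exact Ideal.mem_sup_left (h.symm.pow_mul_prod_mem ha ht (by omega))
      · exact h.pow_mul_prod_mem_sup ha ht (card_pos.1 (by omega)) (by omega)
  · have hat : a ∉ t := fun h => ha (ht h)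
    obtain ⟨i, rfl⟩ := Nat.exists_eq_add_of_le' hj
    rw [mem_mulComap, pow_succ _ i, mul_assoc, ← prod_insert hat]
    refine Ideal.mul_mem_left _ _ (Ideal.mem_sup_left (Ideal.mem_sup_left
      (h.py_mem _ (insert_subset_insert a ht) ?_)))
    rw [card_insert_of_notMem hat]; omega

/-- The quotient by `x a` and `y a`. -/
theorem layer_zero (h : CrossIdeal x y I (insert a s) p q) (ha : a ∉ s) (hs : 1 ≤ #s)
    {L : Ideal S} (hIL : I ≤ L) (hx : x a ∈ L) (hy : y a ∈ L) :
    CrossIdeal x y L s (min p #s) (min q #s) := by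
  have hex := esum_mem ha hx fun k hk => hIL (h.ex_mem k hk)
  have hey := esum_mem ha hy fun k hk => hIL (h.ey_mem k hk)
  refine ⟨fun b hb => ?_, fun b hb => ?_, fun b => hIL (h.xy_mem b), hex, hey,
    fun t ht htp => ?_, fun t ht htq => ?_⟩
  · rcases eq_or_ne b a with rfl | hne
    · exact hx
    · exact hIL (h.x_mem b (by simp [hb, hne]))
  · rcases eq_or_ne b a with rfl | hne
    · exact hy
    · exact hIL (h.y_mem b (by simp [hb, hne]))
  · rcases le_total p #s with hp | hp
    · exact hIL (h.px_mem t (ht.trans (subset_insert _ _)) (by omega))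
    · rw [eq_of_subset_of_card_le ht (by omega), ← esum_card]
      exact hex _ hs
  · rcases le_total q #s with hq | hq
    · exact hIL (h.py_mem t (ht.trans (subset_insert _ _)) (by omega))
    · rw [eq_of_subset_of_card_le ht (by omega), ← esum_card]
      exact hey _ hs

end CrossIdeal

variable [Algebra ℂ S]

/-- The quotient by the ideal `I` has dimension at most `N`. -/
def CodimLE (I : Ideal S) (N : ℚ) : Prop :=
  ∃ W : Submodule ℂ S, FiniteDimensional ℂ W ∧ (Module.finrank ℂ W : ℚ) ≤ N ∧
    I.restrictScalars ℂ ⊔ W = ⊤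

theorem CodimLE.mono {I : Ideal S} {M N : ℚ} (h : CodimLE I M) (hMN : M ≤ N) : CodimLE I N := by
  obtain ⟨W, hf, hW, ht⟩ := h
  exact ⟨W, hf, hW.trans hMN, ht⟩

theorem CodimLE.mono_left {I J : Ideal S} {N : ℚ} (h : CodimLE I N) (hIJ : I ≤ J) :
    CodimLE J N := by
  obtain ⟨W, hf, hW, ht⟩ := h
  refine ⟨W, hf, hW, top_unique (ht ▸ sup_le_sup_right ?_ W)⟩
  exact fun x hx => hIJ hx

theorem codimLE_sup_span_pow (I : Ideal S) (a : S) (c : ℕ → ℚ) (N : ℕ)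
    (hc : ∀ j < N, CodimLE (mulComap (a ^ j) (I ⊔ Ideal.span {a ^ (j + 1)})) (c j)) :
    CodimLE (I ⊔ Ideal.span {a ^ N}) (∑ j ∈ range N, c j) := by
  induction N with
  | zero =>
    refine ⟨⊥, inferInstance, by simp, ?_⟩
    rw [sup_bot_eq, pow_zero, Ideal.span_singleton_one, sup_top_eq]
    rfl
  | succ N ih =>
    obtain ⟨W, hf, hW, ht⟩ := ih fun j hj => hc j (hj.trans N.lt_succ_self)
    obtain ⟨W', hf', hW', ht'⟩ := hc N N.lt_succ_self
    refine ⟨W ⊔ W'.map (LinearMap.mulLeft ℂ (a ^ N)), inferInstance, ?_, ?_⟩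
    · rw [sum_range_succ]
      have h1 := Submodule.finrank_add_le_finrank_add_finrank W
        (W'.map (LinearMap.mulLeft ℂ (a ^ N)))
      have h2 := Submodule.finrank_map_le (LinearMap.mulLeft ℂ (a ^ N)) W'
      have h3 : (Module.finrank ℂ ↥(W ⊔ W'.map (LinearMap.mulLeft ℂ (a ^ N))) : ℚ) ≤
          Module.finrank ℂ W + Module.finrank ℂ W' := by
        exact_mod_cast h1.trans (Nat.add_le_add_left h2 _)
      linarith
    · rw [eq_top_iff]
      intro f _
      obtain ⟨u, hu, w, hw, rfl⟩ := Submodule.mem_sup.1 (ht ▸ Submodule.mem_top : f ∈ _)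
      obtain ⟨i, hi, z, hz, rfl⟩ := Submodule.mem_sup.1 ((Submodule.restrictScalars_mem _ _ _).1 hu)
      obtain ⟨g, rfl⟩ := Ideal.mem_span_singleton'.1 hz
      obtain ⟨k, hk, w', hw', rfl⟩ := Submodule.mem_sup.1 (ht' ▸ Submodule.mem_top : g ∈ _)
      rw [show i + (k + w') * a ^ N + w = (i + a ^ N * k) + (w + a ^ N * w') by ring]
      refine Submodule.add_mem_sup ?_ (Submodule.add_mem_sup hw ⟨w', hw', rfl⟩)
      exact add_mem (Ideal.mem_sup_left hi) hk

section LayerSum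

variable {r : ℕ}

theorem two_mul_sum_min_of_le {k : ℕ} (hk : k ≤ r + 1) :
    2 * ∑ i ∈ range k, min (r + 1) (i + 1) = k * (k + 1) := by
  induction k with
  | zero => simp
  | succ k ih =>
    rw [sum_range_succ, mul_add, ih (by omega), min_eq_right hk]
    ring

theorem two_mul_sum_min_of_ge {k : ℕ} (hk : r ≤ k) :
    2 * ∑ i ∈ range k, min (r + 1) (i + 1) + r * (r + 1) = 2 * k * (r + 1) := by
  induction k, hk using Nat.le_induction with
  | base => rw [two_mul_sum_min_of_le r.le_succ]; ring
  | succ k hk ih =>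
    rw [sum_range_succ, mul_add, min_eq_left (by omega)]
    linarith

/-- The total of the layer bounds. -/
theorem sum_layers {m P Q : ℕ} (hm : 1 ≤ m) (hP : P ≤ m) (hQ : Q ≤ m) (h : P + Q + 1 = m + r) :
    (min (P + 1) m + min (Q + 1) m + 1 - m) +
      ∑ j ∈ range Q, (min (P + 1) (max 1 (m - (j + 1))) + Q + 1 - m) +
      ∑ j ∈ range P, (P + min (Q + 1) (m - j) + 1 - m) = (m + 1) * (r + 1) := by
  have hx : ∑ j ∈ range P, (P + min (Q + 1) (m - j) + 1 - m) + 1 =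
      ∑ i ∈ range (P + 1), min (r + 1) (i + 1) := by
    rw [sum_range_succ', ← sum_range_reflect]
    congr 1
    · refine sum_congr rfl fun j hj => ?_
      have := mem_range.1 hj
      omega
    · omega
  have hy : ∑ j ∈ range Q, (min (P + 1) (max 1 (m - (j + 1))) + Q + 1 - m) =
      ∑ i ∈ range Q, min (r + 1) (i + 1) + if Q = m then 1 else 0 := by
    have h1 : ∀ j ∈ range Q, min (P + 1) (max 1 (m - (j + 1))) + Q + 1 - m =
        min (r + 1) (Q - j) + if m - 1 = j then 1 else 0 := by
      intro j hj
      have := mem_range.1 hj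
      split_ifs <;> omega
    rw [sum_congr rfl h1, sum_add_distrib, sum_ite_eq, ← sum_range_reflect]
    congr 1
    · refine sum_congr rfl fun j hj => ?_
      have := mem_range.1 hj
      omega
    · simp only [mem_range]
      split_ifs <;> omega
  rw [hy]
  have h1 := two_mul_sum_min_of_ge (r := r) (k := P + 1) (by omega)
  generalize ∑ i ∈ range (P + 1), min (r + 1) (i + 1) = A at *
  rcases hP.lt_or_eq with hP | rfl
  · have h2 := two_mul_sum_min_of_ge (r := r) (k := Q) (by omega)
    generalize ∑ i ∈ range Q, min (r + 1) (i + 1) = B at *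
    have h3 : A + B = m * (r + 1) := by
      have : (P + Q + 1) * (r + 1) = (m + r) * (r + 1) := by rw [h]
      nlinarith
    rw [add_mul, one_mul, ← h3]
    split_ifs <;> omega
  · have h2 := two_mul_sum_min_of_le (r := r) (k := Q) (by omega)
    generalize ∑ i ∈ range Q, min (r + 1) (i + 1) = B at *
    obtain rfl : r = Q + 1 := by omega
    have h3 : A + B + (Q + 1) = (P + 1) * (Q + 1 + 1) := by nlinarith
    rw [← h3]
    split_ifs <;> omega

end LayerSum

open scoped Nat in
/-- The dimension bound for the quotient by a `CrossIdeal`. -/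
theorem CrossIdeal.codimLE {x y : ι → S}
    (h1 : ∀ L : Ideal S, (∀ i, x i ∈ L) → (∀ i, y i ∈ L) → CodimLE L 1) {n : ℕ} :
    ∀ {s : Finset ι} {p q r : ℕ} {I : Ideal S}, #s = n → 1 ≤ p → p ≤ n → 1 ≤ q → q ≤ n →
      p + q = n + r → CrossIdeal x y I s p q → CodimLE I (n ! * (r + 1) / 2) := by
  induction n with
  | zero => intros; omega
  | succ m ih =>
    intro s p q r I hs hp hpn hq hqn hr h
    obtain ⟨a, s, ha, rfl, hm⟩ := card_eq_succ.1 hs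
    rcases Nat.eq_zero_or_pos m with rfl | hm0
    · obtain rfl : p = 1 := by omega
      obtain rfl : q = 1 := by omega
      obtain rfl : r = 1 := by omega
      refine (h1 I (fun i => ?_) fun i => ?_).mono (by norm_num)
      · by_cases hi : i ∈ insert a s
        · simpa using h.px_mem {i} (by simpa using hi) (by simp)
        · exact h.x_mem i hi
      · by_cases hi : i ∈ insert a s
        · simpa using h.py_mem {i} (by simpa using hi) (by simp)
        · exact h.y_mem i hi
    obtain ⟨P, rfl⟩ := Nat.exists_eq_add_of_le' hp
    obtain ⟨Q, rfl⟩ := Nat.exists_eq_add_of_le' hq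
    have hle {N : ℕ} (c : ℕ → ℚ) {J : Ideal S} {b : S} (hb : b ^ N ∈ J)
        (hc : ∀ j < N, CodimLE (mulComap (b ^ j) (J ⊔ Ideal.span {b ^ (j + 1)})) (c j)) :
        CodimLE J (∑ j ∈ range N, c j) := by
      have := codimLE_sup_span_pow J b c N hc
      rwa [sup_eq_left.2 ((Ideal.span_singleton_le_iff_mem J).2 hb)] at this
    let u (p q : ℕ) : ℚ := m ! * ((p + q + 1 - m : ℕ) : ℚ) / 2
    have hu {p q : ℕ} {J : Ideal S} (hp : 1 ≤ p) (hpm : p ≤ m) (hq : 1 ≤ q) (hqm : q ≤ m)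
        (hpq : m ≤ p + q) (h : CrossIdeal x y J s p q) : CodimLE J (u p q) := by
      obtain ⟨r, hr⟩ := Nat.exists_eq_add_of_le hpq
      refine (ih hm hp hpm hq hqm hr h).mono (le_of_eq ?_)
      simp only [u]
      rw [show p + q + 1 - m = r + 1 by omega]
      push_cast
      ring
    let cy (j : ℕ) : ℚ := match j with
      | 0 => u (min (P + 1) m) (min (Q + 1) m)
      | j + 1 => u (min (P + 1) (max 1 (m - (j + 1)))) Q
    have hIx : CodimLE (I ⊔ Ideal.span {x a}) (∑ j ∈ range (Q + 1), cy j) := by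
      refine hle (b := y a) cy (Ideal.mem_sup_left (h.symm.pow_mem ha hq)) fun j hj => ?_
      rcases j with _ | j
      · refine hu (by omega) (by omega) (by omega) (by omega) (by omega) ?_
        rw [← hm]
        have hle : I ⊔ Ideal.span {x a} ≤
            mulComap (y a ^ 0) (I ⊔ Ideal.span {x a} ⊔ Ideal.span {y a ^ (0 + 1)}) := by
          intro f hf
          rw [mem_mulComap, pow_zero, one_mul]
          exact Ideal.mem_sup_left hf
        refine h.layer_zero ha (by omega) (le_sup_left.trans hle)
          (hle (Ideal.mem_sup_right (Ideal.mem_span_singleton_self _))) ?_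
        rw [mem_mulComap, pow_zero, one_mul, zero_add, pow_one]
        exact Ideal.mem_sup_right (Ideal.mem_span_singleton_self _)
      · refine hu (by omega) (by omega) (by omega) (by omega) (by omega) ?_
        have := h.layer_y ha (by omega) (j := j + 1) (by omega) (by omega)
        rwa [hm, Nat.add_sub_cancel] at this
    let cx (j : ℕ) : ℚ := match j with
      | 0 => ∑ j ∈ range (Q + 1), cy j
      | j + 1 => u P (min (Q + 1) (m - j))
    refine (hle (b := x a) cx (h.pow_mem ha hp) fun j hj => ?_).mono (le_of_eq ?_)
    · rcases j with _ | j
      · refine hIx.mono_left fun f hf => ?_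
        rw [mem_mulComap, pow_zero, one_mul, zero_add, pow_one]
        exact hf
      · refine hu (by omega) (by omega) (by omega) (by omega) (by omega) ?_
        have := h.layer_x ha (by omega) (j := j + 1) (by omega) (by omega)
        rwa [hm, Nat.add_sub_cancel, show m + 1 - (j + 1) = m - j by omega] at this
    · have := sum_layers hm0 (by omega) (by omega) (show P + Q + 1 = m + r by omega)
      rw [sum_range_succ']
      simp only [cx, cy, u]
      rw [sum_range_succ']
      simp only [← sum_div, ← mul_sum, ← Nat.cast_sum]
      rw [Nat.factorial_succ]
      push_cast [← this]
      have h2 : (((m + 1) * (r + 1) : ℕ) : ℚ) = (m + 1) * (r + 1) := by push_cast; ring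
      rw [← this] at h2
      push_cast at h2 ⊢
      linear_combination (m ! / 2 : ℚ) * h2

end CrossBound

section Averaging

open Finset

variable {G V T : Type*} [Group G] [Fintype G] [AddCommGroup V] [Module ℂ V] [AddCommGroup T]
  [Module ℂ T] (ρ : Representation ℂ G V) (A : Representation ℂ G T)

/-- The average of a linear map over a finite group. -/
def averageMap (p : V →ₗ[ℂ] T) : V →ₗ[ℂ] T :=
  (Fintype.card G : ℂ)⁻¹ • ∑ g : G, A g⁻¹ ∘ₗ p ∘ₗ ρ g

theorem averageMap_equivariant (p : V →ₗ[ℂ] T) (h : G) (v : V) :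
    averageMap ρ A p (ρ h v) = A h (averageMap ρ A p v) := by
  simp only [averageMap, LinearMap.smul_apply, LinearMap.sum_apply, LinearMap.comp_apply,
    map_smul, map_sum]
  congr 1
  refine Fintype.sum_equiv (Equiv.mulRight h) _ _ fun g => ?_
  simp only [Equiv.coe_mulRight, mul_inv_rev, map_mul, Module.End.mul_apply]
  rw [Representation.self_inv_apply]

theorem averageMap_eq {p : V →ₗ[ℂ] T} {v : V} {t : T} (h : ∀ g, A g⁻¹ (p (ρ g v)) = t) :
    averageMap ρ A p v = t := by
  simp only [averageMap, LinearMap.smul_apply, LinearMap.sum_apply, LinearMap.comp_apply, h]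
  rw [sum_const, card_univ, ← Nat.cast_smul_eq_nsmul ℂ, inv_smul_smul₀]
  exact_mod_cast Fintype.card_ne_zero

/-- Maschke: an invariant subspace is the image of an equivariant projection. -/
theorem exists_equivariant_projection (W : Submodule ℂ T) (hW : ∀ g, ∀ w ∈ W, A g w ∈ W) :
    ∃ e : T →ₗ[ℂ] T, (∀ t, e t ∈ W) ∧ (∀ w ∈ W, e w = w) ∧ ∀ g t, e (A g t) = A g (e t) := by
  obtain ⟨r, hr⟩ := W.subtype.exists_leftInverse_of_injective W.ker_subtype
  refine ⟨averageMap A A (W.subtype ∘ₗ r), fun t => ?_, fun w hw => averageMap_eq A A fun g => ?_,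
    averageMap_equivariant A A _⟩
  · simp only [averageMap, LinearMap.smul_apply, LinearMap.sum_apply, LinearMap.comp_apply]
    exact W.smul_mem _ (W.sum_mem fun g _ => hW _ _ (r _).2)
  · have := LinearMap.congr_fun hr ⟨_, hW g w hw⟩
    simp only [LinearMap.comp_apply, Submodule.subtype_apply, LinearMap.id_apply] at this ⊢
    rw [this]
    exact A.inv_self_apply g w

/-- An equivariant map that vanishes on `K ⊓ N` can be changed outside `K` so as to vanish
on `N`. -/
theorem exists_equivariant_extension {K N : Submodule ℂ V} (hK : ∀ g, ∀ v ∈ K, ρ g v ∈ K)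
    (hN : ∀ g, ∀ v ∈ N, ρ g v ∈ N) {p : V →ₗ[ℂ] T} (hp : ∀ g v, p (ρ g v) = A g (p v))
    (hKN : ∀ v ∈ K, v ∈ N → p v = 0) :
    ∃ q : V →ₗ[ℂ] T, (∀ g v, q (ρ g v) = A g (q v)) ∧ (∀ v ∈ K, q v = p v) ∧
      ∀ v ∈ N, q v = 0 := by
  let j : K →ₗ[ℂ] V ⧸ N := N.mkQ ∘ₗ K.subtype
  have hj : LinearMap.ker j ≤ LinearMap.ker (p ∘ₗ K.subtype) := by
    intro v hv
    exact hKN v v.2 ((Submodule.Quotient.mk_eq_zero N).1 hv)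
  obtain ⟨l, hl⟩ := ((LinearMap.ker j).liftQ (p ∘ₗ K.subtype) hj ∘ₗ
    j.quotKerEquivRange.symm.toLinearMap).exists_extend
  have hl' : ∀ v : K, l (j v) = p v := by
    intro v
    have h1 := LinearMap.congr_fun hl ⟨j v, v, rfl⟩
    have h2 : j.quotKerEquivRange.symm ⟨j v, v, rfl⟩ = Submodule.Quotient.mk v := by
      rw [LinearEquiv.symm_apply_eq]
      rfl
    simpa [h2] using h1
  refine ⟨averageMap ρ A (l ∘ₗ N.mkQ), averageMap_equivariant ρ A _,
    fun v hv => averageMap_eq ρ A fun g => ?_, fun v hv => averageMap_eq ρ A fun g => ?_⟩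
  · have : (l ∘ₗ N.mkQ) (ρ g v) = p (ρ g v) := hl' ⟨_, hK g v hv⟩
    rw [this, hp, A.inv_self_apply]
  · have : N.mkQ (ρ g v) = 0 := (Submodule.Quotient.mk_eq_zero N).2 (hN g v hv)
    rw [LinearMap.comp_apply, this, map_zero, map_zero]

end Averaging

theorem ker_le_of_finrank_le {V T : Type*} [AddCommGroup V] [Module ℂ V] [AddCommGroup T]
    [Module ℂ T] {ψ : V →ₗ[ℂ] T} {I W : Submodule ℂ V} [FiniteDimensional ℂ W]
    (hI : I ≤ LinearMap.ker ψ) (hW : I ⊔ W = ⊤)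
    (hr : Module.finrank ℂ W ≤ Module.finrank ℂ (LinearMap.range ψ)) : LinearMap.ker ψ ≤ I := by
  have hrange : LinearMap.range (ψ ∘ₗ W.subtype) = LinearMap.range ψ := by
    refine le_antisymm (LinearMap.range_comp_le_range _ _) ?_
    rintro _ ⟨v, rfl⟩
    obtain ⟨i, hi, w, hw, rfl⟩ := Submodule.mem_sup.1 (hW ▸ Submodule.mem_top : v ∈ I ⊔ W)
    exact ⟨⟨w, hw⟩, by simp [LinearMap.mem_ker.1 (hI hi)]⟩
  have h1 := LinearMap.finrank_range_add_finrank_ker (ψ ∘ₗ W.subtype)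
  rw [hrange] at h1
  have h2 : LinearMap.ker (ψ ∘ₗ W.subtype) = ⊥ :=
    Submodule.finrank_eq_zero.1 (by omega)
  intro v hv
  obtain ⟨i, hi, w, hw, rfl⟩ := Submodule.mem_sup.1 (hW ▸ Submodule.mem_top : v ∈ I ⊔ W)
  have h3 : (⟨w, hw⟩ : W) ∈ LinearMap.ker (ψ ∘ₗ W.subtype) := by
    have := LinearMap.mem_ker.1 hv
    rw [map_add, LinearMap.mem_ker.1 (hI hi), zero_add] at this
    exact this
  rw [h2, Submodule.mem_bot, Subtype.ext_iff] at h3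
  rw [show w = 0 from h3, add_zero]
  exact hi

section Deformation

open Finset

variable {σ : Type*}

/-- The polynomials of degree less than `d`. -/
def degLT (σ : Type*) (d : ℕ) : Submodule ℂ (MvPolynomial σ ℂ) where
  carrier := {f | ∀ i, d ≤ i → homogeneousComponent i f = 0}
  add_mem' := fun hf hg i hi => by rw [map_add, hf i hi, hg i hi, add_zero]
  zero_mem' := fun i _ => map_zero _
  smul_mem' := fun c f hf i hi => by rw [map_smul, hf i hi, smul_zero]

theorem degLT_mono : Monotone (degLT σ) := fun _ _ h _ hf i hi => hf i (h.trans hi)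

theorem exists_mem_degLT (f : MvPolynomial σ ℂ) : ∃ d, f ∈ degLT σ d :=
  ⟨f.totalDegree + 1, fun _ hi => homogeneousComponent_eq_zero _ _ hi⟩

theorem degLT_zero : degLT σ 0 = ⊥ := by
  refine eq_bot_iff.2 fun f hf => ?_
  rw [Submodule.mem_bot, ← sum_homogeneousComponent f]
  exact sum_eq_zero fun i _ => hf i i.zero_le

theorem homogeneousComponent_homogeneousComponent (i d : ℕ) (f : MvPolynomial σ ℂ) :
    homogeneousComponent i (homogeneousComponent d f) =
      if i = d then homogeneousComponent d f else 0 :=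
  homogeneousComponent_of_mem (homogeneousComponent_mem d f)

theorem sub_homogeneousComponent_mem {d : ℕ} {f : MvPolynomial σ ℂ} (hf : f ∈ degLT σ (d + 1)) :
    f - homogeneousComponent d f ∈ degLT σ d := by
  intro i hi
  rw [map_sub, homogeneousComponent_homogeneousComponent]
  split_ifs with h
  · rw [h, sub_self]
  · rw [hf i (by omega), sub_zero]

theorem homogeneousComponent_mem_degLT {d e : ℕ} (h : d < e) (f : MvPolynomial σ ℂ) :
    homogeneousComponent d f ∈ degLT σ e := by
  intro i hi
  rw [homogeneousComponent_homogeneousComponent, if_neg (by omega)]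

theorem homogeneousComponent_mul_of_isHomogeneous {g : MvPolynomial σ ℂ} {k : ℕ}
    (hg : g.IsHomogeneous k) (d : ℕ) (f : MvPolynomial σ ℂ) :
    homogeneousComponent d (g * f) = if k ≤ d then g * homogeneousComponent (d - k) f else 0 := by
  conv_lhs => rw [← sum_homogeneousComponent f, mul_sum, map_sum]
  have h : ∀ i, homogeneousComponent d (g * homogeneousComponent i f) =
      if d = k + i then g * homogeneousComponent i f else 0 := fun i =>
    homogeneousComponent_of_mem (hg.mul (homogeneousComponent_isHomogeneous i f))
  simp only [h]
  split_ifs with hkd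
  · rw [sum_eq_single (d - k)]
    · rw [if_pos (by omega)]
    · intro i _ hi
      rw [if_neg (by omega)]
    · intro hi
      rw [homogeneousComponent_eq_zero _ _ (by rw [mem_range] at hi; omega), mul_zero, ite_self]
  · exact sum_eq_zero fun i _ => if_neg (by omega)

variable {G : Set (MvPolynomial σ ℂ)}

theorem homogeneousComponent_mem_span (hG : ∀ g ∈ G, ∃ k, 0 < k ∧ g.IsHomogeneous k)
    {f : MvPolynomial σ ℂ} (hf : f ∈ Ideal.span G) (d : ℕ) :
    homogeneousComponent d f ∈ Submodule.span ℂ {b | ∃ g ∈ G, ∃ h ∈ degLT σ d, b = g * h} := by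
  suffices h : ∀ a d, homogeneousComponent d (a * f) ∈
      Submodule.span ℂ {b | ∃ g ∈ G, ∃ h ∈ degLT σ d, b = g * h} by
    simpa using h 1 d
  clear d
  induction hf using Submodule.span_induction with
  | mem g hg =>
    intro a d
    obtain ⟨k, hk, hgk⟩ := hG g hg
    rw [mul_comm, homogeneousComponent_mul_of_isHomogeneous hgk]
    split_ifs
    · exact Submodule.subset_span ⟨g, hg, _, homogeneousComponent_mem_degLT (by omega) _, rfl⟩
    · exact zero_mem _
  | zero => simp
  | add f g _ _ hf hg => intro a d; rw [mul_add, map_add]; exact add_mem (hf a d) (hg a d)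
  | smul b f _ ih => intro a d; rw [smul_eq_mul, ← mul_assoc]; exact ih (a * b) d

theorem homogeneousComponent_mem_ideal_span (hG : ∀ g ∈ G, ∃ k, 0 < k ∧ g.IsHomogeneous k)
    {f : MvPolynomial σ ℂ} (hf : f ∈ Ideal.span G) (d : ℕ) :
    homogeneousComponent d f ∈ Ideal.span G := by
  have h : Submodule.span ℂ {b | ∃ g ∈ G, ∃ h ∈ degLT σ d, b = g * h} ≤
      (Ideal.span G).restrictScalars ℂ := by
    rw [Submodule.span_le]
    rintro _ ⟨g, hg, h, -, rfl⟩
    exact Ideal.mul_mem_right _ _ (Ideal.subset_span hg)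
  exact h (homogeneousComponent_mem_span hG hf d)

/-- If `φ` is an eigenvector for the multiplication by each generator, then the top component of
an element of the ideal takes a value that is already attained in lower degree. -/
theorem map_homogeneousComponent_mem {T : Type*} [AddCommGroup T] [Module ℂ T]
    (hG : ∀ g ∈ G, ∃ k, 0 < k ∧ g.IsHomogeneous k) {φ : MvPolynomial σ ℂ →ₗ[ℂ] T}
    (hφ : ∀ g ∈ G, ∃ c : ℂ, ∀ f, φ (g * f) = c • φ f)
    {f : MvPolynomial σ ℂ} (hf : f ∈ Ideal.span G) (d : ℕ) :
    φ (homogeneousComponent d f) ∈ (degLT σ d).map φ := by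
  have h : Submodule.span ℂ {b | ∃ g ∈ G, ∃ h ∈ degLT σ d, b = g * h} ≤
      ((degLT σ d).map φ).comap φ := by
    rw [Submodule.span_le]
    rintro _ ⟨g, hg, h, hh, rfl⟩
    obtain ⟨c, hc⟩ := hφ g hg
    rw [SetLike.mem_coe, Submodule.mem_comap, hc]
    exact Submodule.smul_mem _ _ (Submodule.mem_map_of_mem hh)
  exact h (homogeneousComponent_mem_span hG hf d)

variable {Γ T : Type*} [Group Γ] [Fintype Γ] [AddCommGroup T] [Module ℂ T]
  [FiniteDimensional ℂ T]

/-- Degeneration to the associated graded: an equivariant map `φ` may be replaced by a map with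
the same image that kills every `f` whose components take values attained in lower degree. -/
theorem exists_deformation {ρ : Representation ℂ Γ (MvPolynomial σ ℂ)}
    {A : Representation ℂ Γ T} (hρ : ∀ g d f, homogeneousComponent d (ρ g f) =
      ρ g (homogeneousComponent d f)) {V : Submodule ℂ (MvPolynomial σ ℂ)}
    (hV : ∀ v ∈ V, ∀ d, homogeneousComponent d v ∈ V) (hVρ : ∀ g, ∀ v ∈ V, ρ g v ∈ V)
    {φ : MvPolynomial σ ℂ →ₗ[ℂ] T} (hφ : ∀ g f, φ (ρ g f) = A g (φ f)) :
    ∃ ψ : MvPolynomial σ ℂ →ₗ[ℂ] T, (∀ g f, ψ (ρ g f) = A g (ψ f)) ∧ V.map ψ = V.map φ ∧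
      ∀ f, (∀ d, φ (homogeneousComponent d f) ∈ (V ⊓ degLT σ d).map φ) → ψ f = 0 := by
  have hmono : Monotone fun d => (V ⊓ degLT σ d).map φ := fun _ _ h =>
    Submodule.map_mono (inf_le_inf_left _ (degLT_mono h))
  obtain ⟨D, hD⟩ := monotone_stabilizes_iff_noetherian.2 inferInstance ⟨_, hmono⟩
  have hstab : V.map φ ≤ (V ⊓ degLT σ D).map φ := by
    rintro _ ⟨v, hv, rfl⟩
    obtain ⟨d, hd⟩ := exists_mem_degLT v
    have h1 := hmono (le_max_right D d) (Submodule.mem_map_of_mem (f := φ) ⟨hv, hd⟩)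
    have h2 := hD (max D d) (le_max_left _ _)
    simp only [OrderHom.coe_mk] at h2
    rw [h2]
    exact h1
  have hstable (d : ℕ) (g : Γ) : ∀ w ∈ (V ⊓ degLT σ d).map φ, A g w ∈ (V ⊓ degLT σ d).map φ := by
    rintro _ ⟨v, ⟨hv, hd⟩, rfl⟩
    rw [← hφ]
    refine Submodule.mem_map_of_mem ⟨hVρ g v hv, fun i hi => ?_⟩
    rw [hρ, hd i hi, map_zero]
  choose e he1 he2 he3 using fun d => exists_equivariant_projection A _ (hstable d)
  let ψ : MvPolynomial σ ℂ →ₗ[ℂ] T :=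
    ∑ d ∈ range D, (LinearMap.id - e d) ∘ₗ φ ∘ₗ homogeneousComponent d
  have hψ (f : MvPolynomial σ ℂ) : ψ f = ∑ d ∈ range D,
      (φ (homogeneousComponent d f) - e d (φ (homogeneousComponent d f))) := by
    simp [ψ]
  refine ⟨ψ, fun g f => ?_, le_antisymm ?_ (hstab.trans ?_), fun f hf => ?_⟩
  · simp only [hψ, hρ, hφ, he3, map_sum, map_sub]
  · rintro _ ⟨v, hv, rfl⟩
    rw [hψ]
    exact Submodule.sum_mem _ fun d _ => Submodule.sub_mem _
      (Submodule.mem_map_of_mem (hV v hv d)) (Submodule.map_mono inf_le_left (he1 d _))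
  · suffices h : ∀ d ≤ D, (V ⊓ degLT σ d).map φ ≤ V.map ψ from h D le_rfl
    intro d
    induction d with
    | zero => simp [degLT_zero]
    | succ d ih =>
      rintro hd _ ⟨v, ⟨hv, hvd⟩, rfl⟩
      have hvd' := hV v hv d
      have h1 : ψ (homogeneousComponent d v) =
          φ (homogeneousComponent d v) - e d (φ (homogeneousComponent d v)) := by
        rw [hψ, sum_eq_single d]
        · rw [homogeneousComponent_homogeneousComponent, if_pos rfl]
        · intro i _ hi
          rw [homogeneousComponent_homogeneousComponent, if_neg hi, map_zero, map_zero, sub_zero]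
        · intro h
          exact absurd (mem_range.2 hd) h
      have h2 : φ v = φ (v - homogeneousComponent d v) + ψ (homogeneousComponent d v) +
          e d (φ (homogeneousComponent d v)) := by
        rw [h1, map_sub]
        abel
      rw [h2]
      exact add_mem (add_mem (ih (by omega) (Submodule.mem_map_of_mem
        ⟨sub_mem hv hvd', sub_homogeneousComponent_mem hvd⟩)) (Submodule.mem_map_of_mem hvd'))
        (ih (by omega) (he1 d _))
  · rw [hψ]
    exact sum_eq_zero fun d _ => by rw [he2 d _ (hf d), sub_self]

end Deformation

section Layer

open Finset

variable {σ Γ T₀ T : Type*} [Group Γ] [Fintype Γ] [AddCommGroup T₀] [Module ℂ T₀]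
  [FiniteDimensional ℂ T₀] [AddCommGroup T] [Module ℂ T] [FiniteDimensional ℂ T]
  {ρ : Representation ℂ Γ (MvPolynomial σ ℂ)} {A₀ : Representation ℂ Γ T₀}
  {A : Representation ℂ Γ T} {G : Set (MvPolynomial σ ℂ)}

theorem exists_deformation_span (hρ : ∀ g d f, homogeneousComponent d (ρ g f) =
      ρ g (homogeneousComponent d f)) (hG : ∀ g ∈ G, ∃ k, 0 < k ∧ g.IsHomogeneous k)
    {φ : MvPolynomial σ ℂ →ₗ[ℂ] T} (hφ : ∀ g f, φ (ρ g f) = A g (φ f))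
    (hφG : ∀ g ∈ G, ∃ c : ℂ, ∀ f, φ (g * f) = c • φ f) :
    ∃ ψ : MvPolynomial σ ℂ →ₗ[ℂ] T, (∀ g f, ψ (ρ g f) = A g (ψ f)) ∧
      LinearMap.range ψ = LinearMap.range φ ∧ (∀ f ∈ Ideal.span G, ψ f = 0) ∧
      ∀ f, (∀ d, φ (homogeneousComponent d f) ∈ (degLT σ d).map φ) → ψ f = 0 := by
  obtain ⟨ψ, h1, h2, h3⟩ := exists_deformation hρ (V := ⊤) (fun _ _ _ => trivial)
    (fun _ _ _ => trivial) hφ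
  simp only [top_inf_eq, Submodule.map_top] at h2 h3
  exact ⟨ψ, h1, h2, fun f hf => h3 f fun d => map_homogeneousComponent_mem hG hφG hf d, h3⟩

/-- The top component of a polynomial killed by `φ` lies in any large enough ideal `N` of
polynomials whose components take values attained in lower degree. -/
theorem homogeneousComponent_mem_of_codimLE (hρ : ∀ g d f, homogeneousComponent d (ρ g f) =
      ρ g (homogeneousComponent d f)) {φ : MvPolynomial σ ℂ →ₗ[ℂ] T₀}
    (hφ : ∀ g f, φ (ρ g f) = A₀ g (φ f)) {N : Ideal (MvPolynomial σ ℂ)}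
    (hN : ∀ f ∈ N, ∀ d, φ (homogeneousComponent d f) ∈ (degLT σ d).map φ)
    (hcodim : CodimLE N (Module.finrank ℂ (LinearMap.range φ))) {f : MvPolynomial σ ℂ} {d : ℕ}
    (hfd : f ∈ degLT σ (d + 1)) (hf : φ f = 0) : homogeneousComponent d f ∈ N := by
  obtain ⟨ψ, -, h2, h3⟩ := exists_deformation hρ (V := ⊤) (fun _ _ _ => trivial)
    (fun _ _ _ => trivial) hφ
  simp only [top_inf_eq, Submodule.map_top] at h2 h3
  obtain ⟨W, _, hW, hNW⟩ := hcodim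
  have hker := ker_le_of_finrank_le (I := N.restrictScalars ℂ) (ψ := ψ)
    (fun f hf => h3 f (hN f hf)) hNW (by rw [h2]; exact_mod_cast hW)
  refine hker (h3 _ fun i => ?_)
  rw [homogeneousComponent_homogeneousComponent]
  split_ifs with hi
  · subst hi
    refine ⟨-(f - homogeneousComponent i f), neg_mem (sub_homogeneousComponent_mem hfd), ?_⟩
    rw [map_neg, map_sub, hf, zero_sub, neg_neg]
  · rw [map_zero]
    exact zero_mem _

theorem exists_layer_map (hρ : ∀ g d f, homogeneousComponent d (ρ g f) =
      ρ g (homogeneousComponent d f)) (hG : ∀ g ∈ G, ∃ k, 0 < k ∧ g.IsHomogeneous k)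
    (hGρ : ∀ g, ∀ f ∈ Ideal.span G, ρ g f ∈ Ideal.span G)
    {K : Ideal (MvPolynomial σ ℂ)} (hK : ∀ f ∈ K, ∀ d, homogeneousComponent d f ∈ K)
    (hKρ : ∀ g, ∀ f ∈ K, ρ g f ∈ K)
    {φ₀ : MvPolynomial σ ℂ →ₗ[ℂ] T₀} (hφ₀ : ∀ g f, φ₀ (ρ g f) = A₀ g (φ₀ f))
    {φ : MvPolynomial σ ℂ →ₗ[ℂ] T} (hφ : ∀ g f, φ (ρ g f) = A g (φ f))
    (hφG : ∀ g ∈ G, ∃ c : ℂ, ∀ f, φ₀ (g * f) = c • φ₀ f ∧ φ (g * f) = c • φ f)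
    (hφK : ∀ f ∈ K, φ₀ f = 0)
    (hcodim : CodimLE (Ideal.span G ⊔ K) (Module.finrank ℂ (LinearMap.range φ₀))) :
    ∃ ψ : MvPolynomial σ ℂ →ₗ[ℂ] T, (∀ g f, ψ (ρ g f) = A g (ψ f)) ∧
      (∀ f ∈ Ideal.span G, ψ f = 0) ∧
      (K.restrictScalars ℂ).map ψ = (K.restrictScalars ℂ).map φ := by
  have hjoint {f : MvPolynomial σ ℂ} (hf : f ∈ Ideal.span G) (d : ℕ) :
      ∃ h ∈ degLT σ d, φ₀ h = φ₀ (homogeneousComponent d f) ∧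
        φ h = φ (homogeneousComponent d f) := by
    obtain ⟨h, hd, hh⟩ := map_homogeneousComponent_mem hG (φ := φ₀.prod φ) (fun g hg => by
      obtain ⟨c, hc⟩ := hφG g hg
      exact ⟨c, fun f => Prod.ext (hc f).1 (hc f).2⟩) hf d
    exact ⟨h, hd, congrArg Prod.fst hh, congrArg Prod.snd hh⟩
  have htop {f : MvPolynomial σ ℂ} {d : ℕ} (hfd : f ∈ degLT σ (d + 1)) (hf : φ₀ f = 0) :
      homogeneousComponent d f ∈ Ideal.span G ⊔ K := by
    refine homogeneousComponent_mem_of_codimLE hρ hφ₀ (fun f hf d => ?_) hcodim hfd hf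
    obtain ⟨a, ha, k, hk, rfl⟩ := Submodule.mem_sup.1 hf
    obtain ⟨h, hd, hh, -⟩ := hjoint ha d
    exact ⟨h, hd, by rw [hh, map_add, map_add, hφK _ (hK k hk d), add_zero]⟩
  have hclaim (d : ℕ) : ∀ f ∈ degLT σ d, φ₀ f = 0 →
      φ f ∈ (K.restrictScalars ℂ ⊓ degLT σ d).map φ := by
    induction d with
    | zero =>
      intro f hf _
      rw [degLT_zero, Submodule.mem_bot] at hf
      rw [hf, map_zero]
      exact zero_mem _
    | succ d ih =>
      intro f hfd hf
      obtain ⟨a, ha, k, hk, hak⟩ := Submodule.mem_sup.1 (htop hfd hf)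
      have hak' : homogeneousComponent d f =
          homogeneousComponent d a + homogeneousComponent d k := by
        rw [← map_add, hak, homogeneousComponent_homogeneousComponent, if_pos rfl]
      obtain ⟨h, hd, hh₀, hh⟩ := hjoint ha d
      have h1 := ih (f - homogeneousComponent d f + h)
        (add_mem (sub_homogeneousComponent_mem hfd) hd)
        (by rw [map_add, map_sub, hf, hh₀, hak', map_add, hφK _ (hK k hk d)]; abel)
      have h2 : φ f = φ (f - homogeneousComponent d f + h) + φ (homogeneousComponent d k) := by
        rw [map_add, map_sub, hh, hak', map_add]
        abel
      rw [h2]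
      exact add_mem (Submodule.map_mono (inf_le_inf_left _ (degLT_mono d.le_succ)) h1)
        (Submodule.mem_map_of_mem ⟨hK k hk d, homogeneousComponent_mem_degLT d.lt_succ_self _⟩)
  obtain ⟨p, hp1, hp2, hp3⟩ := exists_deformation hρ (V := K.restrictScalars ℂ) hK hKρ hφ
  obtain ⟨ψ, h1, h2, h3⟩ := exists_equivariant_extension ρ A (K := K.restrictScalars ℂ)
    (N := (Ideal.span G).restrictScalars ℂ) hKρ hGρ hp1 (fun v hv hvG => hp3 v fun d => by
      obtain ⟨h, hd, hh₀, hh⟩ := hjoint hvG d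
      rw [← hh]
      exact hclaim d h hd (by rw [hh₀, hφK _ (hK v hv d)]))
  refine ⟨ψ, h1, h3, ?_⟩
  rw [← hp2]
  ext t
  constructor <;> rintro ⟨v, hv, rfl⟩
  · exact ⟨v, hv, (h2 v hv).symm⟩
  · exact ⟨v, hv, h2 v hv⟩

end Layer

section Orbit

open Finset

/-- `ℂ[x₁,…,xₙ,y₁,…,yₙ]`. -/
abbrev PolyXY (n : ℕ) : Type := MvPolynomial (Fin n ⊕ Fin n) ℂ

variable {n : ℕ}

/-- The action of `Sₙ` on `ℂ[x₁,…,xₙ,y₁,…,yₙ]` by permuting indices. -/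
def polyRep (n : ℕ) : Representation ℂ (Equiv.Perm (Fin n)) (PolyXY n) where
  toFun σ := (rename (Sum.map σ σ)).toLinearMap
  map_one' := by
    refine LinearMap.ext fun f => ?_
    simp
  map_mul' σ τ := by
    refine LinearMap.ext fun f => ?_
    simp [rename_rename, Sum.map_comp_map]

theorem polyRep_apply (σ : Equiv.Perm (Fin n)) (f : PolyXY n) :
    polyRep n σ f = rename (Sum.map σ σ) f := rfl

theorem homogeneousComponent_polyRep (σ : Equiv.Perm (Fin n)) (d : ℕ) (f : PolyXY n) :
    homogeneousComponent d (polyRep n σ f) = polyRep n σ (homogeneousComponent d f) :=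
  (rename_homogeneousComponent d f).symm

/-- `regAct` as a representation. -/
def regRep (n : ℕ) : Representation ℂ (Equiv.Perm (Fin n)) (Equiv.Perm (Fin n) → ℂ) where
  toFun σ :=
    { toFun := regAct n σ
      map_add' := fun _ _ => rfl
      map_smul' := fun _ _ => rfl }
  map_one' := by
    refine LinearMap.ext fun f => funext fun τ => ?_
    change f (1⁻¹ * τ) = f τ
    rw [inv_one, one_mul]
  map_mul' σ τ := by
    refine LinearMap.ext fun f => funext fun g => ?_
    change f ((σ * τ)⁻¹ * g) = f (τ⁻¹ * (σ⁻¹ * g))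
    rw [mul_inv_rev, mul_assoc]

theorem regRep_apply (σ : Equiv.Perm (Fin n)) (F : Equiv.Perm (Fin n) → ℂ)
    (τ : Equiv.Perm (Fin n)) : regRep n σ F τ = F (σ⁻¹ * τ) := rfl

variable (wx wy : Fin n → ℂ)

/-- The point with `x_{g j} = wx j` and `y_{g j} = wy j`. -/
def orbitPt (g : Equiv.Perm (Fin n)) : Fin n ⊕ Fin n → ℂ :=
  Sum.elim (fun i => wx (g⁻¹ i)) fun i => wy (g⁻¹ i)

theorem orbitPt_comp (g σ : Equiv.Perm (Fin n)) :
    orbitPt wx wy g ∘ Sum.map σ σ = orbitPt wx wy (σ⁻¹ * g) := by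
  funext i
  rcases i with i | i <;> simp [orbitPt]

theorem eval_orbitPt_polyRep (g σ : Equiv.Perm (Fin n)) (f : PolyXY n) :
    eval (orbitPt wx wy g) (polyRep n σ f) = eval (orbitPt wx wy (σ⁻¹ * g)) f := by
  rw [polyRep_apply, eval_rename, orbitPt_comp]

/-- Evaluation on the orbit of the point `(wx, wy)`. -/
def orbitEval : PolyXY n →ₗ[ℂ] Equiv.Perm (Fin n) → ℂ :=
  LinearMap.pi fun g => (aeval (orbitPt wx wy g)).toLinearMap

theorem orbitEval_apply (f : PolyXY n) (g : Equiv.Perm (Fin n)) :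
    orbitEval wx wy f g = eval (orbitPt wx wy g) f := by
  rw [← aeval_eq_eval]
  rfl

theorem orbitEval_polyRep (σ : Equiv.Perm (Fin n)) (f : PolyXY n) :
    orbitEval wx wy (polyRep n σ f) = regRep n σ (orbitEval wx wy f) := by
  funext g
  rw [regRep_apply, orbitEval_apply, orbitEval_apply, eval_orbitPt_polyRep]

/-- The derivative along `x_{g a} - x_{g b}` at the points of the orbit of `(wx, wy)`. -/
def orbitDeriv (a b : Fin n) : PolyXY n →ₗ[ℂ] Equiv.Perm (Fin n) → ℂ :=
  LinearMap.pi fun g => (aeval (orbitPt wx wy g)).toLinearMap ∘ₗ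
    ((pderiv (Sum.inl (g a))).toLinearMap - (pderiv (Sum.inl (g b))).toLinearMap)

theorem orbitDeriv_apply (a b : Fin n) (f : PolyXY n) (g : Equiv.Perm (Fin n)) :
    orbitDeriv wx wy a b f g = eval (orbitPt wx wy g) (pderiv (Sum.inl (g a)) f) -
      eval (orbitPt wx wy g) (pderiv (Sum.inl (g b)) f) := by
  rw [← map_sub, ← aeval_eq_eval]
  rfl

theorem pderiv_polyRep (σ : Equiv.Perm (Fin n)) (i : Fin n) (f : PolyXY n) :
    pderiv (Sum.inl i) (polyRep n σ f) = polyRep n σ (pderiv (Sum.inl (σ⁻¹ i)) f) := by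
  have h := pderiv_rename (f := Sum.map σ σ) (σ.injective.sumMap σ.injective)
    (Sum.inl (σ⁻¹ i)) f
  rwa [Sum.map_inl, show σ (σ⁻¹ i) = i from σ.apply_symm_apply i] at h

theorem orbitDeriv_polyRep (a b : Fin n) (σ : Equiv.Perm (Fin n)) (f : PolyXY n) :
    orbitDeriv wx wy a b (polyRep n σ f) = regRep n σ (orbitDeriv wx wy a b f) := by
  funext g
  rw [regRep_apply, orbitDeriv_apply, orbitDeriv_apply, pderiv_polyRep, pderiv_polyRep,
    eval_orbitPt_polyRep, eval_orbitPt_polyRep]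
  rfl

variable {wx wy} {a b : Fin n}

theorem orbitPt_mul_swap (hx : wx a = wx b) (hy : wy a = wy b) (g : Equiv.Perm (Fin n)) :
    orbitPt wx wy (g * Equiv.swap a b) = orbitPt wx wy g := by
  have h {w : Fin n → ℂ} (hw : w a = w b) (i : Fin n) : w (Equiv.swap a b i) = w i := by
    rcases eq_or_ne i a with rfl | ha
    · rw [Equiv.swap_apply_left, hw]
    rcases eq_or_ne i b with rfl | hb
    · rw [Equiv.swap_apply_right, hw]
    rw [Equiv.swap_apply_of_ne_of_ne ha hb]
  funext i
  rcases i with i | i <;> simp [orbitPt, h hx, h hy]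

theorem orbitDeriv_mul_swap (hx : wx a = wx b) (hy : wy a = wy b) (f : PolyXY n)
    (g : Equiv.Perm (Fin n)) :
    orbitDeriv wx wy a b f (g * Equiv.swap a b) = -orbitDeriv wx wy a b f g := by
  rw [orbitDeriv_apply, orbitDeriv_apply, orbitPt_mul_swap hx hy]
  simp

theorem orbitDeriv_mul (f g : PolyXY n) (τ : Equiv.Perm (Fin n)) :
    orbitDeriv wx wy a b (g * f) τ = orbitEval wx wy g τ * orbitDeriv wx wy a b f τ +
      orbitDeriv wx wy a b g τ * orbitEval wx wy f τ := by
  simp only [orbitDeriv_apply, orbitEval_apply, Derivation.leibniz, smul_eq_mul, map_add, map_mul]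
  ring

theorem orbitEval_mul (f g : PolyXY n) (τ : Equiv.Perm (Fin n)) :
    orbitEval wx wy (g * f) τ = orbitEval wx wy g τ * orbitEval wx wy f τ := by
  simp only [orbitEval_apply, map_mul]

end Orbit

section Layers

open Finset

variable {n : ℕ}

/-- The squarefree monomial in the `xᵢ`, `i ∈ I`. -/
def prodX (I : Finset (Fin n)) : PolyXY n := ∏ i ∈ I, X (Sum.inl i)

/-- The squarefree monomial in the `yᵢ`, `i ∈ I`. -/
def prodY (I : Finset (Fin n)) : PolyXY n := ∏ i ∈ I, X (Sum.inr i)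

theorem isHomogeneous_prodX (I : Finset (Fin n)) : (prodX I).IsHomogeneous #I := by
  simpa [prodX] using IsHomogeneous.prod I _ (fun _ => 1) fun i _ => isHomogeneous_X ℂ (Sum.inl i)

theorem isHomogeneous_prodY (I : Finset (Fin n)) : (prodY I).IsHomogeneous #I := by
  simpa [prodY] using IsHomogeneous.prod I _ (fun _ => 1) fun i _ => isHomogeneous_X ℂ (Sum.inr i)

theorem polyRep_prodX (σ : Equiv.Perm (Fin n)) (I : Finset (Fin n)) :
    polyRep n σ (prodX I) = prodX (I.map σ.toEmbedding) := by
  simp [polyRep_apply, prodX, map_prod]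

theorem polyRep_prodY (σ : Equiv.Perm (Fin n)) (I : Finset (Fin n)) :
    polyRep n σ (prodY I) = prodY (I.map σ.toEmbedding) := by
  simp [polyRep_apply, prodY, map_prod]

/-- The products `xᵢyᵢ` and the homogeneous invariants of positive degree. -/
def baseGens (n : ℕ) : Set (PolyXY n) :=
  {f | (∃ i, f = X (Sum.inl i) * X (Sum.inr i)) ∨
    (∃ k, 0 < k ∧ f.IsHomogeneous k) ∧ ∀ σ, polyRep n σ f = f}

/-- The generators of the coinvariant ideal, the squarefree products of `m + 1` of the `xᵢ`, and
those of `n - m` of the `yᵢ`. -/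
def layerGens (n m : ℕ) : Set (PolyXY n) :=
  baseGens n ∪ {f | (∃ I : Finset (Fin n), #I = m + 1 ∧ f = prodX I) ∨
    ∃ I : Finset (Fin n), #I = n - m ∧ f = prodY I}

/-- The ideal generated by the squarefree products of `m` of the variables `xᵢ`. -/
def xIdeal (n m : ℕ) : Ideal (PolyXY n) :=
  Ideal.span {f | ∃ I : Finset (Fin n), #I = m ∧ f = prodX I}

theorem baseGens_homogeneous {f : PolyXY n} (hf : f ∈ baseGens n) :
    ∃ k, 0 < k ∧ f.IsHomogeneous k := by
  rcases hf with ⟨i, rfl⟩ | ⟨h, -⟩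
  · exact ⟨2, two_pos, (isHomogeneous_X ℂ _).mul (isHomogeneous_X ℂ _)⟩
  · exact h

theorem layerGens_homogeneous {m : ℕ} (hm : m < n) {f : PolyXY n} (hf : f ∈ layerGens n m) :
    ∃ k, 0 < k ∧ f.IsHomogeneous k := by
  rcases hf with hf | ⟨I, hI, rfl⟩ | ⟨I, hI, rfl⟩
  · exact baseGens_homogeneous hf
  · exact ⟨_, by omega, isHomogeneous_prodX I⟩
  · exact ⟨_, by omega, isHomogeneous_prodY I⟩

theorem polyRep_mem_span {G : Set (PolyXY n)} (σ : Equiv.Perm (Fin n))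
    (hG : ∀ f ∈ G, polyRep n σ f ∈ G) {f : PolyXY n} (hf : f ∈ Ideal.span G) :
    polyRep n σ f ∈ Ideal.span G := by
  have h : Ideal.span G ≤ (Ideal.span G).comap (rename (R := ℂ) (Sum.map σ σ)) :=
    Ideal.span_le.2 fun f hf => Ideal.subset_span (hG f hf)
  exact h hf

theorem polyRep_mem_baseGens (σ : Equiv.Perm (Fin n)) {f : PolyXY n} (hf : f ∈ baseGens n) :
    polyRep n σ f ∈ baseGens n := by
  rcases hf with ⟨i, rfl⟩ | hf
  · exact Or.inl ⟨σ i, by simp [polyRep_apply]⟩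
  · rw [hf.2 σ]
    exact Or.inr hf

theorem polyRep_mem_span_layerGens {m : ℕ} (σ : Equiv.Perm (Fin n)) {f : PolyXY n}
    (hf : f ∈ Ideal.span (layerGens n m)) : polyRep n σ f ∈ Ideal.span (layerGens n m) := by
  refine polyRep_mem_span σ (fun f hf => ?_) hf
  rcases hf with hf | ⟨I, hI, rfl⟩ | ⟨I, hI, rfl⟩
  · exact Or.inl (polyRep_mem_baseGens σ hf)
  · exact Or.inr (Or.inl ⟨_, by rw [card_map, hI], polyRep_prodX σ I⟩)
  · exact Or.inr (Or.inr ⟨_, by rw [card_map, hI], polyRep_prodY σ I⟩)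

theorem polyRep_mem_xIdeal {m : ℕ} (σ : Equiv.Perm (Fin n)) {f : PolyXY n}
    (hf : f ∈ xIdeal n m) : polyRep n σ f ∈ xIdeal n m := by
  refine polyRep_mem_span σ ?_ hf
  rintro _ ⟨I, hI, rfl⟩
  exact ⟨_, by rw [card_map, hI], polyRep_prodX σ I⟩

theorem xIdeal_le_span_layerGens {m k : ℕ} (h : m < k) :
    xIdeal n k ≤ Ideal.span (layerGens n m) := by
  rw [xIdeal, Ideal.span_le]
  rintro _ ⟨I, hI, rfl⟩
  obtain ⟨J, hJI, hJ⟩ := exists_subset_card_eq (show m + 1 ≤ #I by omega)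
  refine Ideal.mem_of_dvd _ (prod_dvd_prod_of_subset _ _ _ hJI)
    (Ideal.subset_span (Or.inr (Or.inl ⟨J, hJ, rfl⟩)))

/-- The `x`-coordinates of the base point of the `m`-th layer. -/
def layerX (n m : ℕ) (j : Fin n) : ℂ := if 2 ≤ (j : ℕ) ∧ (j : ℕ) ≤ m then (j : ℂ) else 0

/-- The `y`-coordinates of the base point of the `m`-th layer. -/
def layerY (n m : ℕ) (j : Fin n) : ℂ := if m < (j : ℕ) then (j : ℂ) else 0

theorem card_filter_val_mem_le (s : Finset ℕ) : #{j : Fin n | (j : ℕ) ∈ s} ≤ #s :=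
  card_le_card_of_injOn Fin.val (by intro j hj; simpa using hj) Fin.val_injective.injOn

theorem exists_mem_eq_zero {w : Fin n → ℂ} {s : Finset ℕ} (hw : ∀ j : Fin n, (j : ℕ) ∉ s → w j = 0)
    {I : Finset (Fin n)} (hI : #s < #I) (τ : Equiv.Perm (Fin n)) : ∃ i ∈ I, w (τ⁻¹ i) = 0 := by
  by_contra! h
  have h1 : I.map (τ⁻¹).toEmbedding ⊆ ({j : Fin n | (j : ℕ) ∈ s} : Finset (Fin n)) := by
    intro j hj
    obtain ⟨i, hi, rfl⟩ := mem_map.1 hj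
    rw [mem_filter_univ]
    by_contra hs
    exact h i hi (hw _ hs)
  have h2 := (card_le_card h1).trans (card_filter_val_mem_le s)
  rw [card_map] at h2
  omega

theorem exists_layerX_eq_zero {m : ℕ} {I : Finset (Fin n)} (hI : m ≤ #I) (hI' : 0 < #I)
    (τ : Equiv.Perm (Fin n)) : ∃ i ∈ I, layerX n m (τ⁻¹ i) = 0 :=
  exists_mem_eq_zero (w := layerX n m) (s := Icc 2 m) (I := I)
    (fun j hj => if_neg (by simpa using hj))
    (by rw [Nat.card_Icc]; omega) τ

theorem exists_layerY_eq_zero {m : ℕ} (hm : m < n) {I : Finset (Fin n)} (hI : n - m ≤ #I)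
    (τ : Equiv.Perm (Fin n)) : ∃ i ∈ I, layerY n m (τ⁻¹ i) = 0 :=
  exists_mem_eq_zero (w := layerY n m) (s := Ioo m n) (I := I)
    (fun j hj => if_neg fun h => hj (mem_Ioo.2 ⟨h, j.2⟩)) (by rw [Nat.card_Ioo]; omega) τ

theorem layerX_mul_layerY (m : ℕ) (j : Fin n) : layerX n m j * layerY n m j = 0 := by
  unfold layerX layerY
  split_ifs <;> first | omega | simp

theorem orbitEval_X_inl (wx wy : Fin n → ℂ) (i : Fin n) (τ : Equiv.Perm (Fin n)) :
    orbitEval wx wy (X (Sum.inl i)) τ = wx (τ⁻¹ i) := by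
  rw [orbitEval_apply, eval_X]
  rfl

theorem orbitEval_X_inr (wx wy : Fin n → ℂ) (i : Fin n) (τ : Equiv.Perm (Fin n)) :
    orbitEval wx wy (X (Sum.inr i)) τ = wy (τ⁻¹ i) := by
  rw [orbitEval_apply, eval_X]
  rfl

theorem orbitEval_prodX (wx wy : Fin n → ℂ) (I : Finset (Fin n)) (τ : Equiv.Perm (Fin n)) :
    orbitEval wx wy (prodX I) τ = ∏ i ∈ I, wx (τ⁻¹ i) := by
  simp only [← orbitEval_X_inl wx wy, orbitEval_apply, prodX, map_prod]

theorem orbitEval_prodY (wx wy : Fin n → ℂ) (I : Finset (Fin n)) (τ : Equiv.Perm (Fin n)) :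
    orbitEval wx wy (prodY I) τ = ∏ i ∈ I, wy (τ⁻¹ i) := by
  simp only [← orbitEval_X_inr wx wy, orbitEval_apply, prodY, map_prod]

theorem orbitDeriv_X_inr (wx wy : Fin n → ℂ) (a b i : Fin n) :
    orbitDeriv wx wy a b (X (Sum.inr i)) = 0 := by
  funext τ
  simp [orbitDeriv_apply]

theorem orbitDeriv_X_inl (wx wy : Fin n → ℂ) (a b i : Fin n) (τ : Equiv.Perm (Fin n)) :
    orbitDeriv wx wy a b (X (Sum.inl i)) τ =
      (if i = τ a then 1 else 0) - if i = τ b then 1 else 0 := by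
  simp only [orbitDeriv_apply, pderiv_X, Pi.single_apply, Sum.inl.injEq]
  split_ifs <;> simp

theorem orbitDeriv_prodY (wx wy : Fin n → ℂ) (a b : Fin n) (I : Finset (Fin n)) :
    orbitDeriv wx wy a b (prodY I) = 0 := by
  induction I using Finset.induction_on with
  | empty => funext τ; simp [prodY, orbitDeriv_apply]
  | insert i I hi ih =>
    funext τ
    rw [prodY, prod_insert hi, ← prodY, orbitDeriv_mul, ih, orbitDeriv_X_inr]
    simp

theorem orbitEval_prodX_eq_zero {m : ℕ} {I : Finset (Fin n)} (hI : m ≤ #I) (hI' : 0 < #I) :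
    orbitEval (layerX n m) (layerY n m) (prodX I) = 0 := by
  funext τ
  obtain ⟨i, hi, h⟩ := exists_layerX_eq_zero hI hI' τ
  rw [orbitEval_prodX, prod_eq_zero hi h]
  rfl

theorem orbitEval_prodY_eq_zero {m : ℕ} (hm : m < n) {I : Finset (Fin n)} (hI : n - m ≤ #I) :
    orbitEval (layerX n m) (layerY n m) (prodY I) = 0 := by
  funext τ
  obtain ⟨i, hi, h⟩ := exists_layerY_eq_zero hm hI τ
  rw [orbitEval_prodY, prod_eq_zero hi h]
  rfl

theorem exists_orbitEval_layerGens {m : ℕ} (hm : m < n) {g : PolyXY n} (hg : g ∈ layerGens n m) :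
    ∃ c : ℂ, ∀ τ, orbitEval (layerX n m) (layerY n m) g τ = c := by
  rcases hg with (⟨i, rfl⟩ | ⟨-, hg⟩) | ⟨I, hI, rfl⟩ | ⟨I, hI, rfl⟩
  · refine ⟨0, fun τ => ?_⟩
    rw [orbitEval_mul, orbitEval_X_inl, orbitEval_X_inr, layerX_mul_layerY]
  · refine ⟨orbitEval (layerX n m) (layerY n m) g 1, fun τ => ?_⟩
    conv_lhs => rw [← hg τ]
    rw [orbitEval_polyRep, regRep_apply, inv_mul_cancel]
  · exact ⟨0, congrFun (orbitEval_prodX_eq_zero (by omega) (by omega))⟩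
  · exact ⟨0, congrFun (orbitEval_prodY_eq_zero hm (by omega))⟩

theorem orbitDeriv_layerGens {m : ℕ} (hm : 1 ≤ m) {a b : Fin n} (ha : (a : ℕ) = 0)
    (hb : (b : ℕ) = 1) {g : PolyXY n} (hg : g ∈ layerGens n m) :
    orbitDeriv (layerX n m) (layerY n m) a b g = 0 := by
  have hYa : layerY n m a = 0 := if_neg (by omega)
  have hYb : layerY n m b = 0 := if_neg (by omega)
  funext τ
  rw [Pi.zero_apply]
  rcases hg with (⟨i, rfl⟩ | ⟨-, hg⟩) | ⟨I, hI, rfl⟩ | ⟨I, hI, rfl⟩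
  · rw [orbitDeriv_mul, orbitDeriv_X_inr, orbitDeriv_X_inl, orbitEval_X_inr]
    split_ifs with h1 h2 h2 <;> simp [h1, h2, hYa, hYb]
  · have hXab : layerX n m a = layerX n m b := by
      rw [layerX, layerX, if_neg (by omega), if_neg (by omega)]
    have h := orbitDeriv_mul_swap hXab (hYa.trans hYb.symm) g τ
    have h2 := congrFun (orbitDeriv_polyRep (layerX n m) (layerY n m) a b
      (τ * Equiv.swap a b * τ⁻¹) g) (τ * Equiv.swap a b)
    rw [hg, regRep_apply, show (τ * Equiv.swap a b * τ⁻¹)⁻¹ * (τ * Equiv.swap a b) = τ by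
      simp [mul_assoc], h] at h2
    linear_combination -h2 / 2
  · obtain ⟨i, hi, h⟩ := exists_layerX_eq_zero (m := m) (I := I) (by omega) (by omega) τ
    have hI' : #(I.erase i) = m := by rw [card_erase_of_mem hi, hI, Nat.add_sub_cancel]
    rw [prodX, ← mul_prod_erase _ _ hi, ← prodX, orbitDeriv_mul, orbitEval_X_inl, h,
      orbitEval_prodX_eq_zero (by omega) (by omega)]
    simp
  · rw [orbitDeriv_prodY]
    rfl

end Layers

section LayerMaps

open Finset

theorem exists_eval_eq_ite {ι Γ : Type*} [Fintype Γ] (p : Γ → ι → ℂ) (τ : Γ)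
    [DecidablePred fun g => p g = p τ] :
    ∃ f : MvPolynomial ι ℂ, ∀ g, eval (p g) f = if p g = p τ then 1 else 0 := by
  have h (g : Γ) : ∃ f : MvPolynomial ι ℂ, eval (p τ) f = 1 ∧ (p g ≠ p τ → eval (p g) f = 0) := by
    by_cases hg : p g = p τ
    · exact ⟨1, map_one _, fun h => absurd hg h⟩
    · obtain ⟨c, hc⟩ := Function.ne_iff.1 hg
      refine ⟨C (p τ c - p g c)⁻¹ * (X c - C (p g c)), ?_, fun _ => by simp⟩
      have : p τ c - p g c ≠ 0 := sub_ne_zero.2 (Ne.symm hc)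
      simp [this]
  choose f h1 h2 using h
  refine ⟨∏ g, f g, fun g => ?_⟩
  rw [map_prod]
  split_ifs with hg
  · exact prod_eq_one fun i _ => by rw [hg, h1]
  · exact prod_eq_zero (mem_univ g) (h2 g hg)

variable {n : ℕ}

/-- The functions on `Sₙ` invariant under right translation by `(1 2)`. -/
def SymInd (n : ℕ) : Submodule ℂ (Equiv.Perm (Fin n) → ℂ) where
  carrier := {f | ∀ g, f (g * swap01 n) = f g}
  zero_mem' _ := rfl
  add_mem' h₁ h₂ g := by simp only [Pi.add_apply, h₁ g, h₂ g]
  smul_mem' c f h g := by simp only [Pi.smul_apply, h g]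

theorem swap01_eq {a b : Fin n} (ha : (a : ℕ) = 0) (hb : (b : ℕ) = 1) :
    swap01 n = Equiv.swap a b := by
  rw [swap01, dif_pos (by omega)]
  congr 1 <;> exact Fin.ext (by simp [ha, hb])

theorem swap01_mul_self (n : ℕ) : swap01 n * swap01 n = 1 := by
  unfold swap01
  split_ifs <;> simp

theorem symInd_sup_signInd (n : ℕ) : SymInd n ⊔ SignInd n = ⊤ := by
  refine eq_top_iff.2 fun F _ => Submodule.mem_sup.2
    ⟨fun g => (F g + F (g * swap01 n)) / 2, fun g => ?_,
      fun g => (F g - F (g * swap01 n)) / 2, fun g => ?_, ?_⟩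
  · simp only [mul_assoc, swap01_mul_self, mul_one]
    ring
  · simp only [mul_assoc, swap01_mul_self, mul_one]
    ring
  · funext g
    simp only [Pi.add_apply]
    ring

/-- Multiplication of functions on `Sₙ` by the sign character. -/
def signMul (n : ℕ) : (Equiv.Perm (Fin n) → ℂ) ≃ₗ[ℂ] (Equiv.Perm (Fin n) → ℂ) :=
  LinearEquiv.piCongrRight fun g => LinearEquiv.smulOfUnit
    (Units.map (Int.castRingHom ℂ : ℤ →* ℂ) (Equiv.Perm.sign g))

theorem signMul_apply (F : Equiv.Perm (Fin n) → ℂ) (g : Equiv.Perm (Fin n)) :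
    signMul n F g = ((Equiv.Perm.sign g : ℤ) : ℂ) * F g := rfl

theorem sign_mul_swap01 (hn : 2 ≤ n) (g : Equiv.Perm (Fin n)) :
    ((Equiv.Perm.sign (g * swap01 n) : ℤ) : ℂ) = -((Equiv.Perm.sign g : ℤ) : ℂ) := by
  rw [swap01_eq (a := ⟨0, by omega⟩) (b := ⟨1, by omega⟩) rfl rfl, Equiv.Perm.sign_mul,
    Equiv.Perm.sign_swap (by simp)]
  simp

theorem finrank_symInd (hn : 2 ≤ n) :
    Module.finrank ℂ (SymInd n) = Module.finrank ℂ (SignInd n) := by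
  refine le_antisymm ?_ ?_
  · rw [← (signMul n).finrank_map_eq (SymInd n)]
    refine Submodule.finrank_mono ?_
    rintro _ ⟨F, hF, rfl⟩ g
    rw [LinearEquiv.coe_coe, signMul_apply, signMul_apply, sign_mul_swap01 hn, hF g, neg_mul]
  · rw [← (signMul n).finrank_map_eq (SignInd n)]
    refine Submodule.finrank_mono ?_
    rintro _ ⟨F, hF, rfl⟩ g
    rw [LinearEquiv.coe_coe, signMul_apply, signMul_apply, sign_mul_swap01 hn, hF g, neg_mul_neg]

theorem finrank_fun_perm (n : ℕ) :
    Module.finrank ℂ (Equiv.Perm (Fin n) → ℂ) = n.factorial := by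
  rw [Module.finrank_fintype_fun_eq_card, Fintype.card_perm, Fintype.card_fin]

theorem factorial_le_two_mul_finrank_signInd (hn : 2 ≤ n) :
    n.factorial ≤ 2 * Module.finrank ℂ (SignInd n) := by
  have h := Submodule.finrank_add_le_finrank_add_finrank (SymInd n) (SignInd n)
  rw [symInd_sup_signInd, finrank_top, finrank_fun_perm, finrank_symInd hn] at h
  omega

theorem orbitPt_layer_eq {m : ℕ} {σ τ : Equiv.Perm (Fin n)}
    (h : orbitPt (layerX n m) (layerY n m) σ = orbitPt (layerX n m) (layerY n m) τ) (i : Fin n)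
    (hi : m = 0 ∨ 2 ≤ (i : ℕ)) : (σ⁻¹ * τ) i = i := by
  have h1 := congrFun h (Sum.inl (τ i))
  have h2 := congrFun h (Sum.inr (τ i))
  simp only [orbitPt, Sum.elim_inl, Sum.elim_inr,
    show τ⁻¹ (τ i) = i from τ.symm_apply_apply i] at h1 h2
  have h3 (j : Fin n) : layerX n m j + layerY n m j =
      ((if m = 0 ∨ 2 ≤ (j : ℕ) then (j : ℕ) else 0 : ℕ) : ℂ) := by
    unfold layerX layerY
    split_ifs <;> first
      | omega
      | simp; done
      | rw [show (j : ℕ) = 0 by omega, Nat.cast_zero, add_zero]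
  have h4 := h3 (σ⁻¹ (τ i))
  rw [h1, h2, h3, Nat.cast_inj, if_pos hi] at h4
  refine Fin.ext (Eq.symm ?_)
  change (i : ℕ) = σ⁻¹ (τ i)
  split_ifs at h4 with h5 <;> omega

theorem orbitPt_layer_zero_injective :
    Function.Injective (orbitPt (layerX n 0) (layerY n 0)) :=
  fun _ _ h => inv_mul_eq_one.1 (Equiv.ext fun i => orbitPt_layer_eq h i (Or.inl rfl))

theorem orbitPt_layer_eq_iff {m : ℕ} (hm : 1 ≤ m) {a b : Fin n} (ha : (a : ℕ) = 0)
    (hb : (b : ℕ) = 1) {σ τ : Equiv.Perm (Fin n)} :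
    orbitPt (layerX n m) (layerY n m) σ = orbitPt (layerX n m) (layerY n m) τ ↔
      σ = τ ∨ σ = τ * Equiv.swap a b := by
  have hX : layerX n m a = layerX n m b := by
    rw [layerX, layerX, if_neg (by omega), if_neg (by omega)]
  have hY : layerY n m a = layerY n m b := by
    rw [layerY, layerY, if_neg (by omega), if_neg (by omega)]
  refine ⟨fun h => ?_, ?_⟩
  · have hu (i : Fin n) (hi : 2 ≤ (i : ℕ)) := orbitPt_layer_eq h i (Or.inr hi)
    obtain ⟨u, rfl⟩ : ∃ u, τ = σ * u := ⟨σ⁻¹ * τ, by rw [mul_inv_cancel_left]⟩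
    simp only [inv_mul_cancel_left] at hu
    have hlt (i : Fin n) (hi : (i : ℕ) < 2) : (u i : ℕ) < 2 := by
      by_contra! h
      rw [u.injective (hu _ h)] at h
      omega
    have hab : a ≠ b := fun h => by rw [h] at ha; omega
    have huab : (u a : ℕ) ≠ u b := fun h => hab (u.injective (Fin.ext h))
    have h1 := hlt a (by omega)
    have h2 := hlt b (by omega)
    have hext {v : Equiv.Perm (Fin n)} (h1 : u a = v a) (h2 : u b = v b)
        (h3 : ∀ i, i ≠ a → i ≠ b → v i = i) : u = v := by
      ext1 i
      rcases eq_or_ne i a with rfl | hia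
      · exact h1
      rcases eq_or_ne i b with rfl | hib
      · exact h2
      rw [h3 i hia hib, hu i]
      have := mt Fin.ext hia
      have := mt Fin.ext hib
      omega
    rcases Nat.lt_or_ge (u a) 1 with h3 | h3
    · left
      rw [hext (v := 1) (Fin.ext (by simp; omega)) (Fin.ext (by simp; omega)) (by simp), mul_one]
    · right
      rw [hext (v := Equiv.swap a b) (Fin.ext (by simp; omega)) (Fin.ext (by simp; omega))
        (fun i hia hib => Equiv.swap_apply_of_ne_of_ne hia hib)]
      simp [mul_assoc]
  · rintro (rfl | rfl)
    · rfl
    · exact orbitPt_mul_swap hX hY τ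

open Classical in
theorem mem_of_single_mem {W : Submodule ℂ (Equiv.Perm (Fin n) → ℂ)} {ε : ℂ} (hε : ε * ε = 1)
    (hW : ∀ τ, (Pi.single τ 1 + ε • Pi.single (τ * swap01 n) 1 : Equiv.Perm (Fin n) → ℂ) ∈ W)
    {F : Equiv.Perm (Fin n) → ℂ} (hF : ∀ g, F (g * swap01 n) = ε * F g) : F ∈ W := by
  have h : F = ∑ τ, (F τ / 2) •
      (Pi.single τ 1 + ε • Pi.single (τ * swap01 n) 1 : Equiv.Perm (Fin n) → ℂ) := by
    funext g
    have hg (τ : Equiv.Perm (Fin n)) : g = τ * swap01 n ↔ g * swap01 n = τ := by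
      constructor <;> rintro rfl <;> rw [mul_assoc, swap01_mul_self, mul_one]
    simp only [Finset.sum_apply, Pi.smul_apply, Pi.add_apply, Pi.single_apply, smul_eq_mul, hg,
      mul_add, mul_ite, mul_one, mul_zero, sum_add_distrib, sum_ite_eq, mem_univ, if_true, hF]
    linear_combination -(F g / 2) * hε
  rw [h]
  exact Submodule.sum_mem _ fun τ _ => W.smul_mem _ (hW τ)

theorem symInd_le_range_orbitEval {m : ℕ} (hm : 1 ≤ m) (hmn : m < n) :
    SymInd n ≤ LinearMap.range (orbitEval (layerX n m) (layerY n m)) := by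
  classical
  let a : Fin n := ⟨0, by omega⟩
  let b : Fin n := ⟨1, by omega⟩
  have hab : a ≠ b := by simp [a, b]
  intro F hF
  refine mem_of_single_mem (ε := 1) (one_mul 1) (fun τ => ?_) (fun g => by rw [one_mul, hF g])
  obtain ⟨f, hf⟩ := exists_eval_eq_ite (orbitPt (layerX n m) (layerY n m)) τ
  refine ⟨f, funext fun g => ?_⟩
  rw [orbitEval_apply, hf, swap01_eq (a := a) (b := b) rfl rfl]
  simp only [orbitPt_layer_eq_iff hm (a := a) (b := b) rfl rfl, Pi.add_apply, Pi.single_apply,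
    one_smul]
  have h : τ ≠ τ * Equiv.swap a b := fun h => hab (by
    simpa using h)
  by_cases h1 : g = τ
  · simp [h1, hab]
  · simp [h1]

theorem signInd_le_map_orbitDeriv {m : ℕ} (hm : 1 ≤ m) (hmn : m < n) {a b : Fin n}
    (ha : (a : ℕ) = 0) (hb : (b : ℕ) = 1) :
    SignInd n ≤ ((xIdeal n m).restrictScalars ℂ).map
      (orbitDeriv (layerX n m) (layerY n m) a b) := by
  classical
  have hXa : layerX n m a = 0 := if_neg (by omega)
  have hXb : layerX n m b = 0 := if_neg (by omega)
  have hYa : layerY n m a = 0 := if_neg (by omega)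
  have hYb : layerY n m b = 0 := if_neg (by omega)
  have hab : a ≠ b := fun h => by rw [h] at ha; omega
  intro F hF
  refine mem_of_single_mem (ε := -1) (by norm_num) (fun τ => ?_)
    (fun g => by rw [neg_one_mul, hF g])
  obtain ⟨f, hf⟩ := exists_eval_eq_ite (orbitPt (layerX n m) (layerY n m)) τ
  let S : Finset (Fin n) := {j | 2 ≤ (j : ℕ) ∧ (j : ℕ) ≤ m}
  have haS : a ∉ S := by simp [S, ha]
  have hS : #S = m - 1 := by
    have : S.map Fin.valEmbedding = Icc 2 m := by
      ext j
      simp only [S, mem_map, mem_filter_univ, Fin.valEmbedding_apply, mem_Icc]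
      exact ⟨fun ⟨i, hi, h⟩ => h ▸ hi, fun h => ⟨⟨j, by omega⟩, h, rfl⟩⟩
    rw [← card_map Fin.valEmbedding, this, Nat.card_Icc]
    omega
  let c : ℂ := ∏ j ∈ S, layerX n m j
  have hc : c ≠ 0 := prod_ne_zero_iff.2 fun j hj => by
    have hj : 2 ≤ (j : ℕ) ∧ (j : ℕ) ≤ m := by simpa [S] using hj
    rw [layerX, if_pos hj, Nat.cast_ne_zero]
    omega
  let I := (insert a S).map τ.toEmbedding
  have hI : #I = m := by rw [card_map, card_insert_of_notMem haS, hS]; omega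
  have hval : orbitDeriv (layerX n m) (layerY n m) a b (prodX I) τ = c := by
    have h1 : prodX I = X (Sum.inl (τ a)) * prodX (S.map τ.toEmbedding) := by
      simp only [prodX, I, prod_map, prod_insert haS, Equiv.coe_toEmbedding]
    rw [h1, orbitDeriv_mul, orbitEval_X_inl, orbitDeriv_X_inl, if_pos rfl,
      if_neg (τ.injective.ne hab), orbitEval_prodX]
    simp [hXa, c]
  have hval' : orbitDeriv (layerX n m) (layerY n m) a b (prodX I) (τ * Equiv.swap a b) = -c := by
    rw [orbitDeriv_mul_swap (hXa.trans hXb.symm) (hYa.trans hYb.symm), hval]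
  refine ⟨c⁻¹ • (prodX I * f), Submodule.smul_mem _ _ (Ideal.mul_mem_right _ _
    (Ideal.subset_span ⟨I, hI, rfl⟩)), funext fun g => ?_⟩
  rw [map_smul, Pi.smul_apply, orbitDeriv_mul, orbitEval_prodX_eq_zero (by omega) (by omega),
    orbitEval_apply, hf, swap01_eq ha hb]
  simp only [orbitPt_layer_eq_iff hm ha hb, Pi.add_apply, Pi.single_apply, Pi.smul_apply,
    Pi.zero_apply]
  by_cases h1 : g = τ
  · subst h1
    simp [hval, hc, hab]
  by_cases h2 : g = τ * Equiv.swap a b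
  · subst h2
    simp [hval', hc, hab]
  · simp [h1, h2]

end LayerMaps

section Bounds

open Finset

variable {n : ℕ}

theorem codimLE_one_of_X_mem {ι : Type*} {L : Ideal (MvPolynomial ι ℂ)} (h : ∀ i, X i ∈ L) :
    CodimLE L 1 := by
  refine ⟨ℂ ∙ 1, inferInstance, by exact_mod_cast finrank_span_le_card {(1 : MvPolynomial ι ℂ)},
    eq_top_iff.2 fun f _ => ?_⟩
  induction f using MvPolynomial.induction_on with
  | C c =>
    refine Submodule.mem_sup_right (Submodule.mem_span_singleton.2 ⟨c, ?_⟩)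
    rw [← C_mul', mul_one]
  | add f g hf hg => exact add_mem (hf trivial) (hg trivial)
  | mul_X f i _ => exact Submodule.mem_sup_left (L.mul_mem_left f (h i))

theorem CrossIdeal.codimLE_polyXY {p q r : ℕ} {I : Ideal (PolyXY n)} (hp : 1 ≤ p) (hpn : p ≤ n)
    (hq : 1 ≤ q) (hqn : q ≤ n) (hr : p + q = n + r)
    (h : CrossIdeal (fun i => X (Sum.inl i)) (fun i => X (Sum.inr i)) I univ p q) :
    CodimLE I (n.factorial * (r + 1) / 2) :=
  CrossIdeal.codimLE (fun _ hx hy => codimLE_one_of_X_mem (Sum.rec hx hy)) (by simp) hp hpn hq hqn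
    hr h

theorem esum_mem_baseGens {k : ℕ} (hk : 1 ≤ k) (s : Fin n → Fin n ⊕ Fin n)
    (hs : ∀ (σ : Equiv.Perm (Fin n)) (i : Fin n), Sum.map σ σ (s i) = s (σ i)) :
    esum univ k (fun i => (X (s i) : PolyXY n)) ∈ baseGens n := by
  refine Or.inr ⟨⟨k, hk, IsHomogeneous.sum _ _ _ fun t ht => ?_⟩, fun σ => ?_⟩
  · simpa [(mem_powersetCard.1 ht).2] using
      IsHomogeneous.prod t _ (fun _ => 1) fun i _ => isHomogeneous_X ℂ (s i)
  · simp only [esum, map_sum, polyRep_apply, map_prod, rename_X, hs]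
    refine sum_equiv σ.finsetCongr (fun t => ?_) fun t _ => ?_
    · simp [mem_powersetCard]
    · simp [prod_map]

theorem crossIdeal_of_baseGens {p q : ℕ} {I : Ideal (PolyXY n)} (hI : baseGens n ⊆ I)
    (hx : ∀ t : Finset (Fin n), #t = p → prodX t ∈ I)
    (hy : ∀ t : Finset (Fin n), #t = q → prodY t ∈ I) :
    CrossIdeal (fun i => X (Sum.inl i)) (fun i => X (Sum.inr i)) I univ p q where
  x_mem i hi := absurd (mem_univ i) hi
  y_mem i hi := absurd (mem_univ i) hi
  xy_mem i := hI (Or.inl ⟨i, rfl⟩)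
  ex_mem _ hk := hI (esum_mem_baseGens hk _ fun _ _ => rfl)
  ey_mem _ hk := hI (esum_mem_baseGens hk _ fun _ _ => rfl)
  px_mem t _ ht := hx t ht
  py_mem t _ ht := hy t ht

theorem codimLE_span_baseGens (hn : 1 ≤ n) :
    CodimLE (Ideal.span (baseGens n)) (n.factorial * (n + 1) / 2) := by
  refine (crossIdeal_of_baseGens Ideal.subset_span (fun t ht => ?_) fun t ht => ?_).codimLE_polyXY
    hn le_rfl hn le_rfl rfl
  all_goals
    obtain rfl : t = univ := by rw [← card_eq_iff_eq_univ, ht, Fintype.card_fin]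
    refine Ideal.subset_span ?_
  · have := esum_mem_baseGens (n := n) (k := #(univ : Finset (Fin n))) (by omega) Sum.inl
      fun _ _ => rfl
    rwa [esum_card] at this
  · have := esum_mem_baseGens (n := n) (k := #(univ : Finset (Fin n))) (by omega) Sum.inr
      fun _ _ => rfl
    rwa [esum_card] at this

theorem codimLE_layer {m : ℕ} (hm : 1 ≤ m) (hmn : m < n) :
    CodimLE (Ideal.span (layerGens n m) ⊔ xIdeal n m) (n.factorial / 2) := by
  have h : CrossIdeal (fun i => X (Sum.inl i)) (fun i => X (Sum.inr i))
      (Ideal.span (layerGens n m) ⊔ xIdeal n m) univ m (n - m) :=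
    crossIdeal_of_baseGens
      (fun f hf => Submodule.mem_sup_left (Ideal.subset_span (Or.inl hf)))
      (fun t ht => Submodule.mem_sup_right (Ideal.subset_span ⟨t, ht, rfl⟩))
      fun t ht => Submodule.mem_sup_left (Ideal.subset_span (Or.inr (Or.inr ⟨t, ht, rfl⟩)))
  simpa using h.codimLE_polyXY (r := 0) hm hmn.le (by omega) (by omega) (by omega)

theorem exists_layer_map_zero (hn : 1 ≤ n) :
    ∃ ψ : PolyXY n →ₗ[ℂ] Equiv.Perm (Fin n) → ℂ,
      (∀ σ f, ψ (polyRep n σ f) = regRep n σ (ψ f)) ∧ (∀ f ∈ Ideal.span (layerGens n 0), ψ f = 0) ∧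
      Function.Surjective ψ := by
  classical
  obtain ⟨ψ, h1, h2, h3, -⟩ := exists_deformation_span (G := layerGens n 0)
    (φ := orbitEval (layerX n 0) (layerY n 0)) homogeneousComponent_polyRep
    (fun g hg => layerGens_homogeneous hn hg) (orbitEval_polyRep _ _) (fun g hg => by
      obtain ⟨c, hc⟩ := exists_orbitEval_layerGens hn hg
      exact ⟨c, fun f => funext fun τ => by rw [orbitEval_mul, hc]; rfl⟩)
  refine ⟨ψ, h1, h3, LinearMap.range_eq_top.1 (h2.trans (eq_top_iff.2 fun F _ => ?_))⟩
  choose f hf using exists_eval_eq_ite (orbitPt (layerX n 0) (layerY n 0))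
  refine ⟨∑ τ, F τ • f τ, funext fun g => ?_⟩
  simp [orbitEval_apply, hf, orbitPt_layer_zero_injective.eq_iff, smul_eval]

theorem exists_layer_map_pos {m : ℕ} (hm : 1 ≤ m) (hmn : m < n) :
    ∃ ψ : PolyXY n →ₗ[ℂ] SignInd n,
      (∀ σ f, ψ (polyRep n σ f) = signIndAct n σ (ψ f)) ∧
      (∀ f ∈ Ideal.span (layerGens n m), ψ f = 0) ∧ ∀ F, ∃ f ∈ xIdeal n m, ψ f = F := by
  let a : Fin n := ⟨0, by omega⟩
  let b : Fin n := ⟨1, by omega⟩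
  have ha : (a : ℕ) = 0 := rfl
  have hb : (b : ℕ) = 1 := rfl
  have hK : ∀ f ∈ xIdeal n m, ∀ d, homogeneousComponent d f ∈ xIdeal n m := fun f hf d =>
    homogeneousComponent_mem_ideal_span
      (by rintro _ ⟨I, hI, rfl⟩; exact ⟨_, by omega, isHomogeneous_prodX I⟩) hf d
  have hφK : ∀ f ∈ xIdeal n m, orbitEval (layerX n m) (layerY n m) f = 0 := by
    intro f hf
    funext τ
    have h : xIdeal n m ≤ RingHom.ker (eval (orbitPt (layerX n m) (layerY n m) τ)) := by
      rw [xIdeal, Ideal.span_le]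
      rintro _ ⟨I, hI, rfl⟩
      rw [SetLike.mem_coe, RingHom.mem_ker, ← orbitEval_apply,
        orbitEval_prodX_eq_zero (by omega) (by omega), Pi.zero_apply]
    rw [orbitEval_apply]
    exact h hf
  have hrank : (n.factorial : ℚ) / 2 ≤
      Module.finrank ℂ (LinearMap.range (orbitEval (layerX n m) (layerY n m))) := by
    have h1 := Submodule.finrank_mono (symInd_le_range_orbitEval hm hmn)
    have h2 := factorial_le_two_mul_finrank_signInd (n := n) (by omega)
    rw [finrank_symInd (by omega)] at h1
    rw [div_le_iff₀ two_pos, mul_comm]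
    exact_mod_cast h2.trans (Nat.mul_le_mul_left 2 h1)
  obtain ⟨ψ, h1, h2, h3⟩ := exists_layer_map (G := layerGens n m) (K := xIdeal n m)
    (φ₀ := orbitEval (layerX n m) (layerY n m))
    (φ := orbitDeriv (layerX n m) (layerY n m) a b) homogeneousComponent_polyRep
    (fun g hg => layerGens_homogeneous hmn hg) (fun σ f hf => polyRep_mem_span_layerGens σ hf) hK
    (fun σ f hf => polyRep_mem_xIdeal σ hf) (orbitEval_polyRep _ _) (orbitDeriv_polyRep _ _ _ _)
    (fun g hg => by
      obtain ⟨c, hc⟩ := exists_orbitEval_layerGens hmn hg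
      refine ⟨c, fun f => ⟨funext fun τ => ?_, funext fun τ => ?_⟩⟩
      · rw [orbitEval_mul, hc]
        rfl
      · rw [orbitDeriv_mul, hc, orbitDeriv_layerGens hm ha hb hg, Pi.zero_apply, zero_mul,
          add_zero]
        rfl) hφK ((codimLE_layer hm hmn).mono hrank)
  obtain ⟨e, he1, he2, he3⟩ := exists_equivariant_projection (regRep n) (SignInd n)
    fun σ F hF => (signIndAct n σ ⟨F, hF⟩).2
  refine ⟨(e ∘ₗ ψ).codRestrict (SignInd n) fun f => he1 _, fun σ f => Subtype.ext ?_,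
    fun f hf => Subtype.ext ?_, fun F => ?_⟩
  · change e (ψ (polyRep n σ f)) = regRep n σ (e (ψ f))
    rw [h1, he3]
  · change e (ψ f) = 0
    rw [h2 f hf, map_zero]
  · have h := signInd_le_map_orbitDeriv hm hmn ha hb F.2
    rw [← h3] at h
    obtain ⟨f, hf, hfF⟩ := h
    refine ⟨f, hf, Subtype.ext ?_⟩
    change e (ψ f) = F
    rw [hfF, he2 _ F.2]

end Bounds

section Coinvariants

open Finset

variable {n : ℕ}

theorem permB_mkB (σ : Equiv.Perm (Fin n)) (f : PolyXY n) :
    permB n σ (mkB n f) = mkB n (polyRep n σ f) := rfl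

theorem ev0_mkB (f : PolyXY n) : ev0 n (mkB n f) = constantCoeff f := by
  change aeval (fun _ => (0 : ℂ)) f = _
  rw [aeval_zero', Algebra.algebraMap_self_apply]

theorem Bideal_le_span_baseGens (n : ℕ) : Bideal n ≤ Ideal.span (baseGens n) := by
  refine Ideal.span_mono ?_
  rintro _ ⟨i, rfl⟩
  exact Or.inl ⟨i, rfl⟩

theorem mem_span_baseGens_of_invariant {f : PolyXY n} (hf : ∀ σ, polyRep n σ f = f)
    (h0 : constantCoeff f = 0) : f ∈ Ideal.span (baseGens n) := by
  rw [← sum_homogeneousComponent f]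
  refine sum_mem fun d _ => ?_
  rcases d with _ | d
  · rw [homogeneousComponent_zero, ← constantCoeff_eq, h0, C_0]
    exact zero_mem _
  · refine Ideal.subset_span (Or.inr ⟨⟨d + 1, d.succ_pos, homogeneousComponent_isHomogeneous _ _⟩,
      fun σ => ?_⟩)
    rw [← homogeneousComponent_polyRep, hf]

theorem exists_invariant_lift {p : B n} (hp : ∀ σ, permB n σ p = p) :
    ∃ f : PolyXY n, (∀ σ, polyRep n σ f = f) ∧ mkB n f = p := by
  obtain ⟨f, rfl⟩ := Ideal.Quotient.mkₐ_surjective ℂ (Bideal n) p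
  have hcard : (Fintype.card (Equiv.Perm (Fin n)) : ℂ) ≠ 0 :=
    Nat.cast_ne_zero.2 Fintype.card_ne_zero
  refine ⟨(Fintype.card (Equiv.Perm (Fin n)) : ℂ)⁻¹ • ∑ τ, polyRep n τ f, fun σ => ?_, ?_⟩
  · rw [map_smul, map_sum]
    congr 1
    refine Fintype.sum_equiv (Equiv.mulLeft σ) _ _ fun τ => ?_
    rw [Equiv.coe_mulLeft, map_mul, Module.End.mul_apply]
  · rw [map_smul, map_sum]
    simp only [← permB_mkB, hp]
    rw [sum_const, card_univ, ← Nat.cast_smul_eq_nsmul ℂ, inv_smul_smul₀ hcard]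

/-- The projection from the polynomial ring onto `Rₙ`. -/
def toRn (n : ℕ) : PolyXY n →ₗ[ℂ] Rn n :=
  ((Ideal.Quotient.mkₐ ℂ (Jn n)).comp (mkB n)).toLinearMap

theorem toRn_apply (f : PolyXY n) : toRn n f = Ideal.Quotient.mk (Jn n) (mkB n f) := rfl

theorem toRn_surjective (n : ℕ) : Function.Surjective (toRn n) :=
  (Ideal.Quotient.mkₐ_surjective ℂ (Jn n)).comp (Ideal.Quotient.mkₐ_surjective ℂ (Bideal n))

theorem ker_toRn (n : ℕ) :
    LinearMap.ker (toRn n) = (Ideal.span (baseGens n)).restrictScalars ℂ := by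
  refine le_antisymm (fun f hf => ?_) ?_
  · rw [LinearMap.mem_ker, toRn_apply, Ideal.Quotient.eq_zero_iff_mem] at hf
    have h : Jn n ≤ (Ideal.span (baseGens n)).map (mkB n) := by
      rw [Jn, Ideal.span_le]
      rintro p ⟨hp, hp0⟩
      obtain ⟨f, hf, rfl⟩ := exists_invariant_lift hp
      rw [ev0_mkB] at hp0
      exact Ideal.mem_map_of_mem _ (mem_span_baseGens_of_invariant hf hp0)
    obtain ⟨g, hg, hgf⟩ := (Ideal.mem_map_iff_of_surjective (mkB n)
      (Ideal.Quotient.mkₐ_surjective ℂ (Bideal n))).1 (h hf)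
    have h2 : g - f ∈ Bideal n := Ideal.Quotient.eq.1 hgf
    have h3 := sub_mem hg (Bideal_le_span_baseGens n h2)
    rwa [sub_sub_cancel] at h3
  · have h : Ideal.span (baseGens n) ≤
        RingHom.ker ((Ideal.Quotient.mkₐ ℂ (Jn n)).comp (mkB n)) := by
      rw [Ideal.span_le]
      rintro f (⟨i, rfl⟩ | ⟨⟨k, hk, hfk⟩, hf⟩)
      · have : mkB n (X (Sum.inl i) * X (Sum.inr i)) = 0 :=
          Ideal.Quotient.eq_zero_iff_mem.2 (Ideal.subset_span ⟨i, rfl⟩)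
        rw [SetLike.mem_coe, RingHom.mem_ker, AlgHom.comp_apply, this, map_zero]
      · refine Ideal.Quotient.eq_zero_iff_mem.2 (Ideal.subset_span ⟨fun σ => ?_, ?_⟩)
        · change permB n σ (mkB n f) = mkB n f
          rw [permB_mkB, hf]
        · change ev0 n (mkB n f) = 0
          rw [ev0_mkB, constantCoeff_eq]
          exact hfk.coeff_eq_zero (by simp [hk.ne])
    exact h

/-- An equivariant surjection killing the coinvariant ideal. -/
theorem exists_total_map (hn : 1 ≤ n) :
    ∃ Ψ : PolyXY n →ₗ[ℂ] (Equiv.Perm (Fin n) → ℂ) × (Fin (n - 1) → SignInd n),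
      (∀ σ f, Ψ (polyRep n σ f) = (regAct n σ (Ψ f).1, fun t => signIndAct n σ ((Ψ f).2 t))) ∧
      (∀ f ∈ Ideal.span (baseGens n), Ψ f = 0) ∧ Function.Surjective Ψ := by
  obtain ⟨ψ₀, h₀ρ, h₀, h₀s⟩ := exists_layer_map_zero hn
  choose ψ hρ hψ hs using fun t : Fin (n - 1) =>
    exists_layer_map_pos (n := n) (m := t + 1) (by omega) (by omega)
  have hle (m : ℕ) : Ideal.span (baseGens n) ≤ Ideal.span (layerGens n m) :=
    Ideal.span_mono Set.subset_union_left
  refine ⟨ψ₀.prod (LinearMap.pi ψ), fun σ f => Prod.ext (h₀ρ σ f) (funext fun t => hρ t σ f),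
    fun f hf => Prod.ext (h₀ f (hle _ hf)) (funext fun t => hψ t f (hle _ hf)), ?_⟩
  rintro ⟨F, s⟩
  suffices h : ∀ j ≤ n - 1, ∃ f, ψ₀ f = F ∧ ∀ t : Fin (n - 1), (t : ℕ) < j → ψ t f = s t by
    obtain ⟨f, h1, h2⟩ := h (n - 1) le_rfl
    exact ⟨f, Prod.ext h1 (funext fun t => h2 t t.2)⟩
  intro j
  induction j with
  | zero =>
    obtain ⟨f, hf⟩ := h₀s F
    exact fun _ => ⟨f, hf, fun t ht => absurd ht t.1.not_lt_zero⟩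
  | succ j ih =>
    intro hj
    obtain ⟨f, h1, h2⟩ := ih (by omega)
    let u : Fin (n - 1) := ⟨j, hj⟩
    obtain ⟨k, hk, hks⟩ := hs u (s u - ψ u f)
    refine ⟨f + k, ?_, fun t ht => ?_⟩
    · rw [map_add, h1, h₀ k (xIdeal_le_span_layerGens (by omega) hk), add_zero]
    · rw [map_add]
      rcases Nat.lt_succ_iff_lt_or_eq.1 ht with ht | ht
      · rw [h2 t ht, hψ t k (xIdeal_le_span_layerGens (by simp only [u]; omega) hk), add_zero]
      · obtain rfl : t = u := Fin.ext ht
        rw [hks, add_sub_cancel]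

theorem le_finrank_target (hn : 1 ≤ n) :
    (n.factorial * (n + 1) / 2 : ℚ) ≤
      Module.finrank ℂ ((Equiv.Perm (Fin n) → ℂ) × (Fin (n - 1) → SignInd n)) := by
  rw [Module.finrank_prod, finrank_fun_perm, Module.finrank_pi_fintype, sum_const, card_univ,
    Fintype.card_fin, smul_eq_mul, div_le_iff₀ two_pos]
  obtain ⟨m, rfl⟩ := Nat.exists_eq_add_of_le' hn
  rcases Nat.eq_zero_or_pos m with rfl | hm
  · norm_num
  · have h := Nat.mul_le_mul_left m (factorial_le_two_mul_finrank_signInd (n := m + 1) (by omega))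
    have h' : (m * (m + 1).factorial : ℚ) ≤ m * (2 * Module.finrank ℂ (SignInd (m + 1))) := by
      exact_mod_cast h
    rw [Nat.add_sub_cancel]
    push_cast
    linarith

end Coinvariants

/-- For every `n ≥ 1`, the symmetric coinvariant algebra `Rₙ = Bₙ/Jₙ` is
isomorphic, as a `ℂ[Sₙ]`-module, to the direct sum of the regular representation `ℂ[Sₙ]`
and `n − 1` copies of `Ind^{Sₙ}_{S₂} L_{(1,1)}`. The isomorphism is a `ℂ`-linear
equivalence commuting with the `Sₙ`-actions (expressed on representatives). -/
theorem symmetric_coinvariant_algebra_structure (n : ℕ) (hn : 1 ≤ n) :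
    ∃ e : Rn n ≃ₗ[ℂ] (Equiv.Perm (Fin n) → ℂ) × (Fin (n - 1) → SignInd n),
      ∀ (σ : Equiv.Perm (Fin n)) (P : B n),
        e (Ideal.Quotient.mk (Jn n) (permB n σ P)) =
          (regAct n σ (e (Ideal.Quotient.mk (Jn n) P)).1,
            fun t => signIndAct n σ ((e (Ideal.Quotient.mk (Jn n) P)).2 t)) := by
  obtain ⟨Ψ, hρ, h0, hs⟩ := exists_total_map hn
  obtain ⟨W, _, hW, hJW⟩ := (codimLE_span_baseGens hn).mono (le_finrank_target hn)
  have hker : LinearMap.ker (toRn n) = LinearMap.ker Ψ := by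
    rw [ker_toRn]
    refine le_antisymm h0 (ker_le_of_finrank_le h0 hJW ?_)
    rw [LinearMap.range_eq_top.2 hs, finrank_top]
    exact_mod_cast hW
  let e := ((toRn n).quotKerEquivOfSurjective (toRn_surjective n)).symm ≪≫ₗ
    Submodule.quotEquivOfEq _ _ hker ≪≫ₗ Ψ.quotKerEquivOfSurjective hs
  have he (f : PolyXY n) : e (Ideal.Quotient.mk (Jn n) (mkB n f)) = Ψ f := by
    have h : ((toRn n).quotKerEquivOfSurjective (toRn_surjective n)).symm (toRn n f) =
        Submodule.Quotient.mk f := by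
      rw [LinearEquiv.symm_apply_eq]
      rfl
    rw [← toRn_apply, LinearEquiv.trans_apply, LinearEquiv.trans_apply, h]
    rfl
  refine ⟨e, fun σ P => ?_⟩
  obtain ⟨f, rfl⟩ := Ideal.Quotient.mkₐ_surjective ℂ (Bideal n) P
  rw [permB_mkB, he, he, hρ]

end
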